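/- arXiv:1301.4660 — 4 statements merged into one kernel-verified Lean document; each statement's English description precedes it below -/
import Mathlib

section
/- Fix s ≥ 0 and τ > 0. Define κ₁ = 4√2·τ/((4s+1)(4s+2τ+1)), κ₂ = 4√2·τ·(2π)^{2τ}/((4s+2τ+1)(4s+4τ+1)), κ₃ = 1/(4s+1) − 2/(4s+2τ+1) + 1/(4s+4τ+1), and c(τ,s) = (2·(κ₁/κ₂)^{-(4s+1)/(2τ)}·κ₃/κ₁²)^{1/2}. Let σ : ℤ → ℝ with σ_0 = 1 and σ_k = |k|^s for k ≠ 0. For r > 0 set T(r) = (κ₁/κ₂)^{1/(2τ)} r^{-1/τ}, v(r) = (1/κ₁)(κ₂/κ₁)^{(4s+1)/(2τ)} r^{2+(4s+1)/τ}, and θ_k(r)² = √2 · v(r) · σ_k⁴ · max(0, 1 − (|k|/T(r))^{2τ}) for k ∈ ℤ. Then, as r → 0⁺: (i) r^{-2} ∑_{k∈ℤ} θ_k(r)² → 1; (ii) (2π)^{2τ} ∑_{k∈ℤ} |k|^{2τ} θ_k(r)² → 1; and (iii) V(r) := (∑_{k∈ℤ} θ_k(r)⁴/(2σ_k⁴))^{1/2}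 satisfies V(r)/(c(τ,s)·r^{2+(4s+1)/(2τ)}) → 1. -/
open scoped BigOperators

noncomputable section

/-- `κ₁` from Proposition 3.1. -/
def kappa1 (s τ : ℝ) : ℝ := 4 * Real.sqrt 2 * τ / ((4 * s + 1) * (4 * s + 2 * τ + 1))

/-- `κ₂` from Proposition 3.1. -/
def kappa2 (s τ : ℝ) : ℝ :=
  4 * Real.sqrt 2 * τ * (2 * Real.pi) ^ (2 * τ) / ((4 * s + 2 * τ + 1) * (4 * s + 4 * τ + 1))

/-- `κ₃` from Proposition 3.1. -/
def kappa3 (s τ : ℝ) : ℝ :=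
  1 / (4 * s + 1) - 2 / (4 * s + 2 * τ + 1) + 1 / (4 * s + 4 * τ + 1)

/-- The constant `c(τ,s)` from Proposition 3.1. -/
def cConst (s τ : ℝ) : ℝ :=
  Real.sqrt (2 * (kappa1 s τ / kappa2 s τ) ^ (-(4 * s + 1) / (2 * τ)) *
    kappa3 s τ / (kappa1 s τ) ^ 2)

/-- The standard deviations: `σ 0 = 1` and `σ k = |k|^s` for `k ≠ 0`. -/
def sigmaSeq (s : ℝ) (k : ℤ) : ℝ := if k = 0 then 1 else |(k : ℝ)| ^ s

/-- The truncation level `T(r)`. -/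
def Tlevel (s τ r : ℝ) : ℝ := (kappa1 s τ / kappa2 s τ) ^ (1 / (2 * τ)) * r ^ (-(1 / τ))

/-- The scaling `v(r)`. -/
def vScale (s τ r : ℝ) : ℝ :=
  (1 / kappa1 s τ) * (kappa2 s τ / kappa1 s τ) ^ ((4 * s + 1) / (2 * τ)) *
    r ^ (2 + (4 * s + 1) / τ)

/-- The square of the extremal sequence: `θ_k(r)²`. -/
def thetaSq (s τ r : ℝ) (k : ℤ) : ℝ :=
  Real.sqrt 2 * vScale s τ r * (sigmaSeq s k) ^ 4 *
    max 0 (1 - (|(k : ℝ)| / Tlevel s τ r) ^ (2 * τ))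

/-- The value `V(r) = (∑_k θ_k(r)⁴/(2σ_k⁴))^{1/2}`. -/
def Vvalue (s τ r : ℝ) : ℝ :=
  Real.sqrt (∑' k : ℤ, (thetaSq s τ r k) ^ 2 / (2 * (sigmaSeq s k) ^ 4))

/-- The power sum `∑_{k=1}^{⌊T⌋} k^a`. -/
def floorPowerSum (a T : ℝ) : ℝ := ∑ i ∈ Finset.range ⌊T⌋₊, ((i : ℝ) + 1) ^ a

lemma sum_range_add_one_rpow_bounds {a : ℝ} (ha : 0 ≤ a) (N : ℕ) :
    (N : ℝ) ^ (a + 1) / (a + 1) ≤ ∑ i ∈ Finset.range N, ((i : ℝ) + 1) ^ a ∧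
    ∑ i ∈ Finset.range N, ((i : ℝ) + 1) ^ a ≤ (N : ℝ) ^ (a + 1) / (a + 1) + (N : ℝ) ^ a := by
  have hmono : MonotoneOn (fun x : ℝ => x ^ a) (Set.Icc 0 (0 + (N : ℝ))) :=
    fun x hx y _ hxy => Real.rpow_le_rpow hx.1 hxy ha
  have hint : ∫ x in (0 : ℝ)..0 + (N : ℝ), x ^ a = (N : ℝ) ^ (a + 1) / (a + 1) := by
    rw [integral_rpow (Or.inl (by linarith)), Real.zero_rpow (by linarith : a + 1 ≠ 0)]
    simp
  have hlow := hmono.integral_le_sum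
  have hupp := hmono.sum_le_integral
  rw [hint] at hlow hupp
  simp only [zero_add, Nat.cast_add, Nat.cast_one] at hlow hupp
  refine ⟨hlow, ?_⟩
  have h1 := Finset.sum_range_succ (fun i : ℕ => (i : ℝ) ^ a) N
  have h2 := Finset.sum_range_succ' (fun i : ℕ => (i : ℝ) ^ a) N
  simp only [Nat.cast_add, Nat.cast_one] at h2
  have h3 : 0 ≤ ((0 : ℕ) : ℝ) ^ a := Real.rpow_nonneg (by simp) a
  linarith

lemma tendsto_floorPowerSum_div {a : ℝ} (ha : 0 ≤ a) :
    Filter.Tendsto (fun T : ℝ => floorPowerSum a T / T ^ (a + 1)) Filter.atTop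
      (nhds (1 / (a + 1))) := by
  have hx : Filter.Tendsto (fun T : ℝ => (⌊T⌋₊ : ℝ) / T) Filter.atTop (nhds 1) :=
    tendsto_nat_floor_div_atTop
  have hpow : ∀ b : ℝ, Filter.Tendsto (fun T : ℝ => ((⌊T⌋₊ : ℝ) / T) ^ b) Filter.atTop
      (nhds 1) := fun b => by
    simpa using hx.rpow_const (p := b) (Or.inl one_ne_zero)
  have hlow := (hpow (a + 1)).div_const (a + 1)
  have hupp := hlow.add ((hpow a).mul tendsto_inv_atTop_zero)
  rw [mul_zero, add_zero] at hupp
  refine tendsto_of_tendsto_of_tendsto_of_le_of_le' hlow hupp ?_ ?_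
  · filter_upwards [Filter.eventually_gt_atTop 0] with T hT
    have hTp : 0 < T ^ (a + 1) := Real.rpow_pos_of_pos hT _
    rw [Real.div_rpow (Nat.cast_nonneg _) hT.le, div_right_comm]
    exact div_le_div_of_nonneg_right (sum_range_add_one_rpow_bounds ha _).1 hTp.le
  · filter_upwards [Filter.eventually_gt_atTop 0] with T hT
    have hTp : 0 < T ^ (a + 1) := Real.rpow_pos_of_pos hT _
    refine (div_le_div_of_nonneg_right (sum_range_add_one_rpow_bounds ha _).2 hTp.le).trans_eq ?_
    rw [Real.div_rpow (Nat.cast_nonneg _) hT.le, Real.div_rpow (Nat.cast_nonneg _) hT.le,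
      add_div, div_right_comm, Real.rpow_add_one hT.ne' a]
    field_simp

lemma tsum_int_eq_of_even_of_eq_zero {f : ℤ → ℝ} {T : ℝ} (heven : ∀ k, f (-k) = f k)
    (hzero : ∀ k : ℤ, T < |(k : ℝ)| → f k = 0) :
    ∑' k, f k = f 0 + 2 * ∑ i ∈ Finset.range ⌊T⌋₊, f ((i : ℤ) + 1) := by
  have hsum : HasSum (fun n : ℕ => f ((n : ℤ) + 1))
      (∑ i ∈ Finset.range ⌊T⌋₊, f ((i : ℤ) + 1)) := by
    refine hasSum_sum_of_ne_finset_zero fun n hn => hzero _ ?_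
    rw [Finset.mem_range, not_lt] at hn
    push_cast
    rw [abs_of_nonneg (by positivity)]
    exact (Nat.lt_floor_add_one T).trans_le (by exact_mod_cast Nat.succ_le_succ hn)
  have hneg : HasSum (fun n : ℕ => f (-((n : ℤ) + 1)))
      (∑ i ∈ Finset.range ⌊T⌋₊, f ((i : ℤ) + 1)) := by
    simpa only [heven] using hsum
  rw [(HasSum.of_add_one_of_neg_add_one hsum hneg).tsum_eq]
  ring

lemma add_one_le_of_mem_range_floor {T : ℝ} {i : ℕ} (hi : i ∈ Finset.range ⌊T⌋₊) :
    (i : ℝ) + 1 ≤ T := by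
  have h := (Nat.le_floor_iff' (Nat.succ_ne_zero i)).1 (Nat.succ_le_of_lt (Finset.mem_range.1 hi))
  exact_mod_cast h

lemma sigmaSeq_neg (s : ℝ) (k : ℤ) : sigmaSeq s (-k) = sigmaSeq s k := by
  simp [sigmaSeq]

lemma sigmaSeq_zero (s : ℝ) : sigmaSeq s 0 = 1 := by
  simp [sigmaSeq]

lemma sigmaSeq_add_one_pow_four (s : ℝ) (i : ℕ) :
    sigmaSeq s ((i : ℤ) + 1) ^ 4 = ((i : ℝ) + 1) ^ (4 * s) := by
  have hi : (0 : ℝ) ≤ (i : ℝ) + 1 := by positivity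
  have hne : (i : ℤ) + 1 ≠ 0 := by positivity
  rw [sigmaSeq, if_neg hne]
  push_cast
  rw [abs_of_nonneg hi, mul_comm, Real.rpow_mul hi]
  norm_cast

lemma thetaSq_neg (s τ r : ℝ) (k : ℤ) : thetaSq s τ r (-k) = thetaSq s τ r k := by
  simp [thetaSq, sigmaSeq_neg]

lemma thetaSq_zero {s τ r : ℝ} (hτ : 0 < τ) :
    thetaSq s τ r 0 = Real.sqrt 2 * vScale s τ r := by
  simp [thetaSq, sigmaSeq_zero, Real.zero_rpow (by positivity : 2 * τ ≠ 0)]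

lemma thetaSq_eq_zero {s τ r : ℝ} (hτ : 0 < τ) (hT : 0 < Tlevel s τ r) {k : ℤ}
    (hk : Tlevel s τ r < |(k : ℝ)|) : thetaSq s τ r k = 0 := by
  have h := Real.one_le_rpow ((one_le_div hT).2 hk.le) (by positivity : 0 ≤ 2 * τ)
  rw [thetaSq, max_eq_left (by linarith), mul_zero]

lemma thetaSq_add_one {s τ r : ℝ} (hτ : 0 < τ) (hT : 0 < Tlevel s τ r) {i : ℕ}
    (hi : i ∈ Finset.range ⌊Tlevel s τ r⌋₊) :
    thetaSq s τ r ((i : ℤ) + 1) = Real.sqrt 2 * vScale s τ r * ((i : ℝ) + 1) ^ (4 * s) *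
      (1 - ((i : ℝ) + 1) ^ (2 * τ) / Tlevel s τ r ^ (2 * τ)) := by
  have hi0 : (0 : ℝ) ≤ (i : ℝ) + 1 := by positivity
  have h := Real.rpow_le_one (div_nonneg hi0 hT.le)
    ((div_le_one hT).2 (add_one_le_of_mem_range_floor hi)) (by positivity : 0 ≤ 2 * τ)
  rw [thetaSq, sigmaSeq_add_one_pow_four]
  push_cast
  rw [abs_of_nonneg hi0, max_eq_right (by linarith), Real.div_rpow hi0 hT.le]

lemma tsum_thetaSq {s τ r : ℝ} (hτ : 0 < τ) (hT : 0 < Tlevel s τ r) :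
    ∑' k : ℤ, thetaSq s τ r k = Real.sqrt 2 * vScale s τ r *
      (1 + 2 * (floorPowerSum (4 * s) (Tlevel s τ r) -
        floorPowerSum (4 * s + 2 * τ) (Tlevel s τ r) / Tlevel s τ r ^ (2 * τ))) := by
  rw [tsum_int_eq_of_even_of_eq_zero (thetaSq_neg s τ r) fun k hk => thetaSq_eq_zero hτ hT hk,
    thetaSq_zero hτ, Finset.sum_congr rfl fun i hi => thetaSq_add_one hτ hT hi]
  have hsum : ∑ i ∈ Finset.range ⌊Tlevel s τ r⌋₊,
      Real.sqrt 2 * vScale s τ r * ((i : ℝ) + 1) ^ (4 * s) *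
        (1 - ((i : ℝ) + 1) ^ (2 * τ) / Tlevel s τ r ^ (2 * τ)) =
      Real.sqrt 2 * vScale s τ r * (floorPowerSum (4 * s) (Tlevel s τ r) -
        floorPowerSum (4 * s + 2 * τ) (Tlevel s τ r) / Tlevel s τ r ^ (2 * τ)) := by
    rw [floorPowerSum, floorPowerSum, Finset.sum_div, ← Finset.sum_sub_distrib, Finset.mul_sum]
    refine Finset.sum_congr rfl fun i _ => ?_
    rw [Real.rpow_add (by positivity : (0 : ℝ) < (i : ℝ) + 1)]
    ring
  rw [hsum]
  ring

lemma tsum_abs_rpow_mul_thetaSq {s τ r : ℝ} (hτ : 0 < τ) (hT : 0 < Tlevel s τ r) :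
    ∑' k : ℤ, |(k : ℝ)| ^ (2 * τ) * thetaSq s τ r k = Real.sqrt 2 * vScale s τ r *
      (2 * (floorPowerSum (4 * s + 2 * τ) (Tlevel s τ r) -
        floorPowerSum (4 * s + 4 * τ) (Tlevel s τ r) / Tlevel s τ r ^ (2 * τ))) := by
  rw [tsum_int_eq_of_even_of_eq_zero (T := Tlevel s τ r)
    (fun k => by rw [thetaSq_neg, Int.cast_neg, abs_neg])
    fun k hk => by rw [thetaSq_eq_zero hτ hT hk, mul_zero]]
  have hsum : ∑ i ∈ Finset.range ⌊Tlevel s τ r⌋₊,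
      |(((i : ℤ) + 1 : ℤ) : ℝ)| ^ (2 * τ) * thetaSq s τ r ((i : ℤ) + 1) =
      Real.sqrt 2 * vScale s τ r * (floorPowerSum (4 * s + 2 * τ) (Tlevel s τ r) -
        floorPowerSum (4 * s + 4 * τ) (Tlevel s τ r) / Tlevel s τ r ^ (2 * τ)) := by
    rw [floorPowerSum, floorPowerSum, Finset.sum_div, ← Finset.sum_sub_distrib, Finset.mul_sum]
    refine Finset.sum_congr rfl fun i hi => ?_
    have hi0 : (0 : ℝ) < (i : ℝ) + 1 := by positivity
    rw [thetaSq_add_one hτ hT hi]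
    push_cast
    rw [abs_of_pos hi0, show 4 * s + 4 * τ = 4 * s + 2 * τ + 2 * τ by ring,
      Real.rpow_add hi0 (4 * s + 2 * τ), Real.rpow_add hi0 (4 * s)]
    ring
  rw [hsum, Int.cast_zero, abs_zero, Real.zero_rpow (by positivity : 2 * τ ≠ 0)]
  ring

lemma tsum_thetaSq_sq_div {s τ r : ℝ} (hτ : 0 < τ) (hT : 0 < Tlevel s τ r) :
    ∑' k : ℤ, thetaSq s τ r k ^ 2 / (2 * sigmaSeq s k ^ 4) = vScale s τ r ^ 2 *
      (1 + 2 * (floorPowerSum (4 * s) (Tlevel s τ r) -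
        2 * (floorPowerSum (4 * s + 2 * τ) (Tlevel s τ r) / Tlevel s τ r ^ (2 * τ)) +
        floorPowerSum (4 * s + 4 * τ) (Tlevel s τ r) / (Tlevel s τ r ^ (2 * τ)) ^ 2)) := by
  have h2 : Real.sqrt 2 ^ 2 = 2 := Real.sq_sqrt (by norm_num)
  rw [tsum_int_eq_of_even_of_eq_zero (T := Tlevel s τ r)
    (fun k => by rw [thetaSq_neg, sigmaSeq_neg])
    fun k hk => by rw [thetaSq_eq_zero hτ hT hk]; simp]
  have hsum : ∑ i ∈ Finset.range ⌊Tlevel s τ r⌋₊,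
      thetaSq s τ r ((i : ℤ) + 1) ^ 2 / (2 * sigmaSeq s ((i : ℤ) + 1) ^ 4) =
      vScale s τ r ^ 2 * (floorPowerSum (4 * s) (Tlevel s τ r) -
        2 * (floorPowerSum (4 * s + 2 * τ) (Tlevel s τ r) / Tlevel s τ r ^ (2 * τ)) +
        floorPowerSum (4 * s + 4 * τ) (Tlevel s τ r) / (Tlevel s τ r ^ (2 * τ)) ^ 2) := by
    rw [floorPowerSum, floorPowerSum, floorPowerSum, Finset.sum_div, Finset.sum_div,
      Finset.mul_sum, ← Finset.sum_sub_distrib, ← Finset.sum_add_distrib, Finset.mul_sum]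
    refine Finset.sum_congr rfl fun i hi => ?_
    have hi0 : (0 : ℝ) < (i : ℝ) + 1 := by positivity
    have hpow : ((i : ℝ) + 1) ^ (4 * s) ≠ 0 := (Real.rpow_pos_of_pos hi0 _).ne'
    rw [thetaSq_add_one hτ hT hi, sigmaSeq_add_one_pow_four,
      show 4 * s + 4 * τ = 4 * s + 2 * τ + 2 * τ by ring,
      Real.rpow_add hi0 (4 * s + 2 * τ), Real.rpow_add hi0 (4 * s), mul_pow, mul_pow, mul_pow, h2]
    have hTp : Tlevel s τ r ^ (2 * τ) ≠ 0 := (Real.rpow_pos_of_pos hT _).ne'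
    field_simp
    ring
  rw [hsum, thetaSq_zero hτ, sigmaSeq_zero, mul_pow, h2]
  ring

lemma kappa1_pos {s τ : ℝ} (hs : 0 ≤ s) (hτ : 0 < τ) : 0 < kappa1 s τ := by
  unfold kappa1; positivity

lemma kappa2_pos {s τ : ℝ} (hs : 0 ≤ s) (hτ : 0 < τ) : 0 < kappa2 s τ := by
  unfold kappa2; positivity

lemma kappa3_pos {s τ : ℝ} (hs : 0 ≤ s) (hτ : 0 < τ) : 0 < kappa3 s τ := by
  have h : kappa3 s τ = 8 * τ ^ 2 / ((4 * s + 1) * (4 * s + 2 * τ + 1) * (4 * s + 4 * τ + 1)) := by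
    have h1 : 4 * s + 1 ≠ 0 := by positivity
    have h2 : 4 * s + 2 * τ + 1 ≠ 0 := by positivity
    have h3 : 4 * s + 4 * τ + 1 ≠ 0 := by positivity
    unfold kappa3
    field_simp
    ring
  rw [h]; positivity

lemma Tlevel_pos {s τ r : ℝ} (hs : 0 ≤ s) (hτ : 0 < τ) (hr : 0 < r) : 0 < Tlevel s τ r :=
  mul_pos (Real.rpow_pos_of_pos (div_pos (kappa1_pos hs hτ) (kappa2_pos hs hτ)) _)
    (Real.rpow_pos_of_pos hr _)

lemma tendsto_Tlevel_atTop {s τ : ℝ} (hs : 0 ≤ s) (hτ : 0 < τ) :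
    Filter.Tendsto (Tlevel s τ) (nhdsWithin 0 (Set.Ioi 0)) Filter.atTop :=
  (tendsto_rpow_neg_nhdsGT_zero (by simpa using hτ)).const_mul_atTop
    (Real.rpow_pos_of_pos (div_pos (kappa1_pos hs hτ) (kappa2_pos hs hτ)) _)

lemma Tlevel_rpow {s τ r : ℝ} (hs : 0 ≤ s) (hτ : 0 < τ) (hr : 0 < r) (a : ℝ) :
    Tlevel s τ r ^ a = (kappa1 s τ / kappa2 s τ) ^ (a / (2 * τ)) * r ^ (-(a / τ)) := by
  have h := (div_pos (kappa1_pos hs hτ) (kappa2_pos hs hτ)).le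
  rw [Tlevel, Real.mul_rpow (Real.rpow_nonneg h _) (Real.rpow_nonneg hr.le _),
    ← Real.rpow_mul h, ← Real.rpow_mul hr.le]
  congr 2 <;> ring

lemma Tlevel_rpow_two_mul {s τ r : ℝ} (hs : 0 ≤ s) (hτ : 0 < τ) (hr : 0 < r) :
    Tlevel s τ r ^ (2 * τ) = kappa1 s τ / kappa2 s τ / r ^ 2 := by
  rw [Tlevel_rpow hs hτ hr, div_self (by positivity), Real.rpow_one,
    mul_div_cancel_right₀ _ hτ.ne', Real.rpow_neg hr.le, Real.rpow_two, ← div_eq_mul_inv]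

lemma vScale_eq {s τ r : ℝ} (hs : 0 ≤ s) (hτ : 0 < τ) (hr : 0 < r) :
    vScale s τ r = r ^ 2 / kappa1 s τ / Tlevel s τ r ^ (4 * s + 1) := by
  have h := div_pos (kappa1_pos hs hτ) (kappa2_pos hs hτ)
  rw [Tlevel_rpow hs hτ hr, vScale, ← inv_div (kappa1 s τ) (kappa2 s τ), Real.inv_rpow h.le,
    Real.rpow_neg hr.le, Real.rpow_add hr, Real.rpow_two]
  have := (Real.rpow_pos_of_pos h ((4 * s + 1) / (2 * τ))).ne'
  have := (Real.rpow_pos_of_pos hr ((4 * s + 1) / τ)).ne'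
  field_simp

lemma cConst_mul_rpow_sq {s τ r : ℝ} (hs : 0 ≤ s) (hτ : 0 < τ) (hr : 0 < r) :
    (cConst s τ * r ^ (2 + (4 * s + 1) / (2 * τ))) ^ 2 =
      2 * kappa3 s τ * (r ^ 2 / kappa1 s τ) ^ 2 / Tlevel s τ r ^ (4 * s + 1) := by
  have h := div_pos (kappa1_pos hs hτ) (kappa2_pos hs hτ)
  have h3 := kappa3_pos hs hτ
  have hpow : (r ^ (2 + (4 * s + 1) / (2 * τ))) ^ 2 = (r ^ 2) ^ 2 * r ^ ((4 * s + 1) / τ) := by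
    rw [Real.rpow_add hr, mul_pow, Real.rpow_two, ← Real.rpow_mul_natCast hr.le
      ((4 * s + 1) / (2 * τ))]
    congr 2
    push_cast
    field_simp
  rw [mul_pow, hpow, cConst, Real.sq_sqrt (by positivity), Tlevel_rpow hs hτ hr,
    neg_div, Real.rpow_neg h.le, Real.rpow_neg hr.le]
  have := kappa1_pos hs hτ
  have := (Real.rpow_pos_of_pos h ((4 * s + 1) / (2 * τ))).ne'
  have := (Real.rpow_pos_of_pos hr ((4 * s + 1) / τ)).ne'
  field_simp

/-- Proposition 3.1 of the paper: the explicit extremal sequence `θ^⋆(r)` satisfies, as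
`r → 0⁺`, (i) `r^{-2} ∑_k θ_k(r)² → 1`; (ii) `(2π)^{2τ} ∑_k |k|^{2τ} θ_k(r)² → 1`;
(iii) `V(r) ∼ c(τ,s)·r^{2+(4s+1)/(2τ)}`. -/
theorem extremal_sequence_asymptotics (s τ : ℝ) (hs : 0 ≤ s) (hτ : 0 < τ) :
    Filter.Tendsto (fun r : ℝ => r ^ (-(2 : ℝ)) * ∑' k : ℤ, thetaSq s τ r k)
      (nhdsWithin 0 (Set.Ioi 0)) (nhds 1) ∧
    Filter.Tendsto
      (fun r : ℝ => (2 * Real.pi) ^ (2 * τ) * ∑' k : ℤ, |(k : ℝ)| ^ (2 * τ) * thetaSq s τ r k)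
      (nhdsWithin 0 (Set.Ioi 0)) (nhds 1) ∧
    Filter.Tendsto
      (fun r : ℝ => Vvalue s τ r / (cConst s τ * r ^ (2 + (4 * s + 1) / (2 * τ))))
      (nhdsWithin 0 (Set.Ioi 0)) (nhds 1) := by
  have hk1 := kappa1_pos hs hτ
  have hk2 := kappa2_pos hs hτ
  have hk3 := kappa3_pos hs hτ
  have hT := tendsto_Tlevel_atTop hs hτ
  have hinv : Filter.Tendsto (fun r : ℝ => (Tlevel s τ r ^ (4 * s + 1))⁻¹)
      (nhdsWithin 0 (Set.Ioi 0)) (nhds 0) :=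
    ((tendsto_rpow_atTop (by positivity : 0 < 4 * s + 1)).comp hT).inv_tendsto_atTop
  have h0 := (tendsto_floorPowerSum_div (by positivity : 0 ≤ 4 * s)).comp hT
  have h1 := (tendsto_floorPowerSum_div (by positivity : 0 ≤ 4 * s + 2 * τ)).comp hT
  have h2 := (tendsto_floorPowerSum_div (by positivity : 0 ≤ 4 * s + 4 * τ)).comp hT
  have hd0 : 4 * s + 1 ≠ 0 := by positivity
  have hd1 : 4 * s + 2 * τ + 1 ≠ 0 := by positivity
  have hd2 : 4 * s + 4 * τ + 1 ≠ 0 := by positivity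
  have hs2 : Real.sqrt 2 ≠ 0 := by positivity
  have hT1 : ∀ r : ℝ, 0 < r → Tlevel s τ r ^ (4 * s + 2 * τ + 1) =
      Tlevel s τ r ^ (4 * s + 1) * Tlevel s τ r ^ (2 * τ) := fun r hr => by
    rw [← Real.rpow_add (Tlevel_pos hs hτ hr)]; ring_nf
  have hT2 : ∀ r : ℝ, 0 < r → Tlevel s τ r ^ (4 * s + 4 * τ + 1) =
      Tlevel s τ r ^ (4 * s + 1) * (Tlevel s τ r ^ (2 * τ)) ^ 2 := fun r hr => by
    rw [pow_two, ← Real.rpow_add (Tlevel_pos hs hτ hr), ← Real.rpow_add (Tlevel_pos hs hτ hr)]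
    ring_nf
  refine ⟨?_, ?_, ?_⟩
  · have key := ((hinv.add ((h0.sub h1).const_mul 2)).const_mul (Real.sqrt 2 / kappa1 s τ))
    have hlim : Real.sqrt 2 / kappa1 s τ *
        (0 + 2 * (1 / (4 * s + 1) - 1 / (4 * s + 2 * τ + 1))) = 1 := by
      unfold kappa1
      field_simp
      ring
    rw [hlim] at key
    refine key.congr' ?_
    filter_upwards [self_mem_nhdsWithin] with r hr
    rw [Set.mem_Ioi] at hr
    have hp := Tlevel_pos hs hτ hr
    have hp0 := (Real.rpow_pos_of_pos hp (4 * s + 1)).ne'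
    have hp1 := (Real.rpow_pos_of_pos hp (2 * τ)).ne'
    simp only [Function.comp_apply]
    rw [tsum_thetaSq hτ hp, vScale_eq hs hτ hr, hT1 r hr, Real.rpow_neg hr.le, Real.rpow_two]
    field_simp
  · have key := (((h1.sub h2).const_mul 2).const_mul
      ((2 * Real.pi) ^ (2 * τ) * Real.sqrt 2 / kappa2 s τ))
    have hpi : (2 * Real.pi) ^ (2 * τ) ≠ 0 := by positivity
    have hlim : (2 * Real.pi) ^ (2 * τ) * Real.sqrt 2 / kappa2 s τ *
        (2 * (1 / (4 * s + 2 * τ + 1) - 1 / (4 * s + 4 * τ + 1))) = 1 := by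
      unfold kappa2
      field_simp
      ring
    rw [hlim] at key
    refine key.congr' ?_
    filter_upwards [self_mem_nhdsWithin] with r hr
    rw [Set.mem_Ioi] at hr
    have hp := Tlevel_pos hs hτ hr
    have hp0 := (Real.rpow_pos_of_pos hp (4 * s + 1)).ne'
    simp only [Function.comp_apply]
    rw [tsum_abs_rpow_mul_thetaSq hτ hp, vScale_eq hs hτ hr, hT1 r hr, hT2 r hr,
      Tlevel_rpow_two_mul hs hτ hr]
    field_simp
  · have key := ((hinv.add (((h0.sub (h1.const_mul 2)).add h2).const_mul 2)).div_const
      (2 * kappa3 s τ)).sqrt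
    have hlim : (0 + 2 * (1 / (4 * s + 1) - 2 * (1 / (4 * s + 2 * τ + 1)) +
        1 / (4 * s + 4 * τ + 1))) / (2 * kappa3 s τ) = 1 := by
      rw [div_eq_one_iff_eq (by positivity)]
      unfold kappa3
      ring
    rw [hlim, Real.sqrt_one] at key
    refine key.congr' ?_
    filter_upwards [self_mem_nhdsWithin] with r hr
    rw [Set.mem_Ioi] at hr
    have hp := Tlevel_pos hs hτ hr
    have hp0 := (Real.rpow_pos_of_pos hp (4 * s + 1)).ne'
    have hp1 := (Real.rpow_pos_of_pos hp (2 * τ)).ne'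
    have hc : 0 ≤ cConst s τ * r ^ (2 + (4 * s + 1) / (2 * τ)) :=
      mul_nonneg (Real.sqrt_nonneg _) (Real.rpow_nonneg hr.le _)
    simp only [Function.comp_apply]
    rw [Vvalue, ← Real.sqrt_sq hc, ← Real.sqrt_div' _ (sq_nonneg _), cConst_mul_rpow_sq hs hτ hr,
      tsum_thetaSq_sq_div hτ hp, vScale_eq hs hτ hr, hT1 r hr, hT2 r hr]
    congr 1
    field_simp

end
end

section
/- Let S ⊆ ℤ be a finite nonempty set and w : S → ℝ with w_k ≥ 0 for all k ∈ S and ∑_{k∈S} w_k² = 1/2. Let P be the product over k ∈ S of standard Gaussian measures on ℝ. Then for every real λ ≥ 0 with λ · (max_{k∈S} w_k) ≤ 1/4: ∫ exp(λ ∑_{k∈S} w_k (x_k² − 1)) dP(x) = ∏_{k∈S} exp(−λ w_k) (1 − 2λ w_k)^{−1/2}, and moreover exp(λ²/2) ≤ ∫ exp(λ ∑_{k∈S} w_k (x_k² − 1)) dP(x) ≤ exp(λ²/2 + 2λ³ · max_{k∈S} w_k). -/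
open MeasureTheory ProbabilityTheory
open scoped BigOperators

/-- The exponential moment of a centred chi-square variable with one degree of freedom. -/
lemma integral_exp_mul_sq_sub_one_gaussianReal {a : ℝ} (ha : a < 1 / 2) :
    ∫ x, Real.exp (a * (x ^ 2 - 1)) ∂(gaussianReal 0 1)
      = Real.exp (-a) * (1 - 2 * a) ^ (-(1 / 2) : ℝ) := by
  have hpos : 0 < 1 - 2 * a := by linarith
  have hcongr : ∀ x : ℝ, gaussianPDFReal 0 1 x • Real.exp (a * (x ^ 2 - 1))
      = ((√(2 * Real.pi))⁻¹ * Real.exp (-a)) * Real.exp (-((1 - 2 * a) / 2) * x ^ 2) := by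
    intro x
    simp only [gaussianPDFReal, smul_eq_mul, NNReal.coe_one, mul_one, sub_zero, mul_assoc,
      ← Real.exp_add]
    congr 2
    ring
  rw [integral_gaussianReal_eq_integral_smul one_ne_zero]
  simp_rw [hcongr]
  have hdiv : Real.pi / ((1 - 2 * a) / 2) = 2 * Real.pi / (1 - 2 * a) := by field_simp
  rw [integral_const_mul, integral_gaussian, hdiv, Real.sqrt_div (by positivity),
    Real.rpow_neg hpos.le, ← Real.sqrt_eq_rpow]
  have hpi : √(2 * Real.pi) ≠ 0 := by positivity
  field_simp

lemma add_sq_div_two_le_neg_log_one_sub {x : ℝ} (h0 : 0 ≤ x) (h1 : x < 1) :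
    x + x ^ 2 / 2 ≤ -Real.log (1 - x) := by
  have h := sum_le_hasSum (Finset.range 2) (fun n _ => by positivity)
    (Real.hasSum_pow_div_log_of_abs_lt_one (abs_lt.2 ⟨by linarith, h1⟩))
  norm_num [Finset.sum_range_succ] at h
  linarith

lemma neg_log_one_sub_le_add_sq_div_two_add_cube {x : ℝ} (h0 : 0 ≤ x) (h1 : x ≤ 1 / 2) :
    -Real.log (1 - x) ≤ x + x ^ 2 / 2 + x ^ 3 := by
  have h := (abs_le.1 (Real.abs_log_sub_add_sum_range_le
    (abs_lt.2 ⟨by linarith, by linarith⟩ : |x| < 1) 4)).1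
  norm_num [Finset.sum_range_succ, abs_of_nonneg h0] at h
  have hdiv : x ^ 5 / (1 - x) ≤ 2 * x ^ 5 := by
    rw [div_le_iff₀ (by linarith)]
    nlinarith [pow_nonneg h0 5]
  have h4 : x ^ 4 ≤ x ^ 3 / 2 := by nlinarith [pow_nonneg h0 3]
  have h5 : x ^ 5 ≤ x ^ 3 / 4 := by nlinarith [pow_nonneg h0 4]
  linarith [pow_nonneg h0 3]

lemma exp_neg_mul_one_sub_rpow_eq {a : ℝ} (ha : a < 1 / 2) :
    Real.exp (-a) * (1 - 2 * a) ^ (-(1 / 2) : ℝ)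
      = Real.exp (-a - Real.log (1 - 2 * a) / 2) := by
  rw [Real.rpow_def_of_pos (by linarith), ← Real.exp_add]
  ring_nf

/-- Quantitative form of Lemma 5.1 of the paper: under the null, the moment generating
function of the weighted chi-square statistic `t_w = ∑_{k∈S} w_k (η_k² - 1)` equals
`∏_k e^{-λw_k}(1-2λw_k)^{-1/2}`, and for `λ ≥ 0` with `λ·max_k w_k ≤ 1/4` it is bounded
between `exp(λ²/2)` and `exp(λ²/2 + 2λ³ max_k w_k)`. -/
theorem mgf_weighted_chi_square
    (S : Finset ℤ) (hS : S.Nonempty) (w : ℤ → ℝ)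
    (hw0 : ∀ k ∈ S, 0 ≤ w k) (hw2 : ∑ k ∈ S, (w k) ^ 2 = 1 / 2)
    (lam : ℝ) (hlam : 0 ≤ lam) (hlamw : lam * S.sup' hS w ≤ 1 / 4) :
    (∫ x : S → ℝ, Real.exp (lam * ∑ k : S, w k * ((x k) ^ 2 - 1))
        ∂(Measure.pi fun _ : S => gaussianReal 0 1))
      = ∏ k : S, Real.exp (-(lam * w k)) * (1 - 2 * lam * w k) ^ (-(1 / 2) : ℝ) ∧
    Real.exp (lam ^ 2 / 2)
      ≤ ∫ x : S → ℝ, Real.exp (lam * ∑ k : S, w k * ((x k) ^ 2 - 1))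
          ∂(Measure.pi fun _ : S => gaussianReal 0 1) ∧
    (∫ x : S → ℝ, Real.exp (lam * ∑ k : S, w k * ((x k) ^ 2 - 1))
          ∂(Measure.pi fun _ : S => gaussianReal 0 1))
      ≤ Real.exp (lam ^ 2 / 2 + 2 * lam ^ 3 * S.sup' hS w) := by
  have hle : ∀ k : S, w k ≤ S.sup' hS w := fun k => Finset.le_sup' w k.2
  have ha0 : ∀ k : S, 0 ≤ lam * w k := fun k => mul_nonneg hlam (hw0 k k.2)
  have ha : ∀ k : S, lam * w k ≤ 1 / 4 := fun k =>
    (mul_le_mul_of_nonneg_left (hle k) hlam).trans hlamw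
  have hsum : ∑ k : S, (w k) ^ 2 = 1 / 2 := by
    rw [← hw2]
    exact Finset.sum_coe_sort S fun k => (w k) ^ 2
  have hint : (∫ x : S → ℝ, Real.exp (lam * ∑ k : S, w k * ((x k) ^ 2 - 1))
        ∂(Measure.pi fun _ : S => gaussianReal 0 1))
      = ∏ k : S, Real.exp (-(lam * w k)) * (1 - 2 * lam * w k) ^ (-(1 / 2) : ℝ) := by
    simp_rw [Finset.mul_sum, Real.exp_sum, ← mul_assoc lam]
    rw [integral_fintype_prod_eq_prod fun (k : S) y => Real.exp (lam * w k * (y ^ 2 - 1))]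
    refine Finset.prod_congr rfl fun k _ => ?_
    rw [integral_exp_mul_sq_sub_one_gaussianReal (by linarith [ha k]), mul_assoc 2]
  have hexp : ∏ k : S, Real.exp (-(lam * w k)) * (1 - 2 * lam * w k) ^ (-(1 / 2) : ℝ)
      = Real.exp (∑ k : S, (-(lam * w k) - Real.log (1 - 2 * (lam * w k)) / 2)) := by
    rw [Real.exp_sum]
    refine Finset.prod_congr rfl fun k _ => ?_
    rw [mul_assoc 2, exp_neg_mul_one_sub_rpow_eq (by linarith [ha k])]
  refine ⟨hint, ?_, ?_⟩ <;> rw [hint, hexp, Real.exp_le_exp]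
  · calc lam ^ 2 / 2 = ∑ k : S, lam ^ 2 * (w k) ^ 2 := by
          rw [← Finset.mul_sum, hsum]
          ring
      _ ≤ _ := Finset.sum_le_sum fun k _ => by
          have := add_sq_div_two_le_neg_log_one_sub (x := 2 * (lam * w k))
            (by linarith [ha0 k]) (by linarith [ha k])
          linarith
  · calc _ ≤ ∑ k : S, (lam ^ 2 + 4 * lam ^ 3 * S.sup' hS w) * (w k) ^ 2 :=
          Finset.sum_le_sum fun k _ => by
            have hlog := neg_log_one_sub_le_add_sq_div_two_add_cube (x := 2 * (lam * w k))
              (by linarith [ha0 k]) (by linarith [ha k])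
            have hcube : lam ^ 3 * (w k) ^ 2 * w k ≤ lam ^ 3 * (w k) ^ 2 * S.sup' hS w :=
              mul_le_mul_of_nonneg_left (hle k) (by positivity)
            linarith
      _ = lam ^ 2 / 2 + 2 * lam ^ 3 * S.sup' hS w := by
          rw [← Finset.mul_sum, hsum]
          ring
end

section
/- Fix a real number λ ≥ 0. For u ∈ ℝ define F(u) = ∫_ℝ exp( λ·( log cosh(u·x) − u²/2 + u⁴/4 ) ) dγ(x), where γ is the standard Gaussian measure on ℝ. Then F(u) > 0 for all u, and the function u ↦ log F(u) − λ²u⁴/4 is O(u⁶) as u → 0; that is, there exist C > 0 and δ > 0 such that |log F(u) − λ²u⁴/4| ≤ C·u⁶ for all |u| ≤ δ. -/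
open MeasureTheory ProbabilityTheory

lemma nonneg_of_hasDerivAt_nonneg {f f' : ℝ → ℝ} (hf : ∀ x, HasDerivAt f (f' x) x)
    (h0 : f 0 = 0) (hf' : ∀ x, 0 ≤ x → 0 ≤ f' x) {x : ℝ} (hx : 0 ≤ x) : 0 ≤ f x := by
  have hmono : MonotoneOn f (Set.Ici 0) := by
    refine monotoneOn_of_hasDerivWithinAt_nonneg (convex_Ici 0)
      (fun y _ ↦ (hf y).continuousAt.continuousWithinAt)
      (fun y _ ↦ (hf y).hasDerivWithinAt) (fun y hy ↦ hf' y ?_)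
    rw [interior_Ici] at hy
    exact le_of_lt hy
  simpa [h0] using hmono Set.self_mem_Ici hx hx

lemma Real.hasDerivAt_tanh_one_sub_sq (x : ℝ) :
    HasDerivAt Real.tanh (1 - Real.tanh x ^ 2) x := by
  have hc := (Real.cosh_pos x).ne'
  have h := (Real.hasDerivAt_sinh x).div (Real.hasDerivAt_cosh x) hc
  have he : Real.tanh = Real.sinh / Real.cosh := by
    ext y; simp [Real.tanh_eq_sinh_div_cosh]
  rw [he]
  refine h.congr_deriv ?_
  simp only [Pi.div_apply]
  field_simp

lemma Real.hasDerivAt_log_cosh (x : ℝ) :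
    HasDerivAt (fun y ↦ Real.log (Real.cosh y)) (Real.tanh x) x := by
  rw [Real.tanh_eq_sinh_div_cosh]
  exact (Real.hasDerivAt_cosh x).log (Real.cosh_pos x).ne'

lemma Real.tanh_le_self {x : ℝ} (hx : 0 ≤ x) : Real.tanh x ≤ x := by
  have h := nonneg_of_hasDerivAt_nonneg (f := fun y ↦ y - Real.tanh y)
    (fun y ↦ (hasDerivAt_id y).sub (Real.hasDerivAt_tanh_one_sub_sq y)) (by simp)
    (fun y _ ↦ by nlinarith [sq_nonneg (Real.tanh y)]) hx
  linarith

lemma Real.tanh_nonneg_of_nonneg {x : ℝ} (hx : 0 ≤ x) : 0 ≤ Real.tanh x := by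
  rw [Real.tanh_eq_sinh_div_cosh]
  exact div_nonneg (Real.sinh_nonneg_iff.2 hx) (Real.cosh_pos x).le

lemma Real.sub_cube_le_tanh {x : ℝ} (hx : 0 ≤ x) : x - x ^ 3 / 3 ≤ Real.tanh x := by
  have h := nonneg_of_hasDerivAt_nonneg (f := fun y ↦ Real.tanh y - (y - y ^ 3 / 3))
    (fun y ↦ (Real.hasDerivAt_tanh_one_sub_sq y).sub
      ((hasDerivAt_id y).sub ((hasDerivAt_pow 3 y).div_const 3))) (by simp)
    (fun y hy ↦ by
      have := pow_le_pow_left₀ (Real.tanh_nonneg_of_nonneg hy) (Real.tanh_le_self hy) 2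
      norm_num
      linarith) hx
  linarith

lemma Real.tanh_le_taylor_five {x : ℝ} (hx : 0 ≤ x) :
    Real.tanh x ≤ x - x ^ 3 / 3 + 2 * x ^ 5 / 15 := by
  have h := nonneg_of_hasDerivAt_nonneg
    (f := fun y ↦ (y - y ^ 3 / 3 + 2 * y ^ 5 / 15) - Real.tanh y)
    (fun y ↦ (((hasDerivAt_id y).sub ((hasDerivAt_pow 3 y).div_const 3)).add
      (((hasDerivAt_pow 5 y).const_mul 2).div_const 15)).sub
      (Real.hasDerivAt_tanh_one_sub_sq y)) (by simp)
    (fun y hy ↦ by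
      have key : y ^ 2 - 2 * y ^ 4 / 3 ≤ Real.tanh y ^ 2 := by
        rcases le_total 0 (y - y ^ 3 / 3) with h0 | h0
        · have := pow_le_pow_left₀ h0 (Real.sub_cube_le_tanh hy) 2
          nlinarith [sq_nonneg (y ^ 3)]
        · nlinarith [sq_nonneg (Real.tanh y), mul_nonneg hy (neg_nonneg.2 h0),
            sq_nonneg (y ^ 2)]
      norm_num
      linarith) hx
  linarith

lemma Real.abs_log_cosh_sub_taylor_le (x : ℝ) :
    |Real.log (Real.cosh x) - x ^ 2 / 2 + x ^ 4 / 12| ≤ x ^ 6 / 45 := by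
  suffices H : ∀ y : ℝ, 0 ≤ y →
      |Real.log (Real.cosh y) - y ^ 2 / 2 + y ^ 4 / 12| ≤ y ^ 6 / 45 by
    have h := H |x| (abs_nonneg x)
    rwa [Real.cosh_abs, (by decide : Even 2).pow_abs, (by decide : Even 4).pow_abs,
      (by decide : Even 6).pow_abs] at h
  intro y hy
  have h₁ := nonneg_of_hasDerivAt_nonneg
    (f := fun y ↦ Real.log (Real.cosh y) - (y ^ 2 / 2 - y ^ 4 / 12))
    (fun y ↦ (Real.hasDerivAt_log_cosh y).sub
      (((hasDerivAt_pow 2 y).div_const 2).sub ((hasDerivAt_pow 4 y).div_const 12))) (by simp)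
    (fun y hy ↦ by
      have := Real.sub_cube_le_tanh hy
      norm_num
      linarith) hy
  have h₂ := nonneg_of_hasDerivAt_nonneg
    (f := fun y ↦ (y ^ 2 / 2 - y ^ 4 / 12 + y ^ 6 / 45) - Real.log (Real.cosh y))
    (fun y ↦ ((((hasDerivAt_pow 2 y).div_const 2).sub ((hasDerivAt_pow 4 y).div_const 12)).add
      ((hasDerivAt_pow 6 y).div_const 45)).sub (Real.hasDerivAt_log_cosh y)) (by simp)
    (fun y hy ↦ by
      have := Real.tanh_le_taylor_five hy
      norm_num
      linarith) hy
  have := pow_nonneg hy 6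
  rw [abs_le]
  constructor <;> linarith

lemma Real.log_cosh_nonneg (x : ℝ) : 0 ≤ Real.log (Real.cosh x) :=
  Real.log_nonneg (Real.one_le_cosh x)

lemma Real.log_cosh_le_half_sq (x : ℝ) : Real.log (Real.cosh x) ≤ x ^ 2 / 2 :=
  (Real.log_le_iff_le_exp (Real.cosh_pos x)).2 (Real.cosh_le_exp_half_sq x)

lemma Real.log_cosh_le_abs (x : ℝ) : Real.log (Real.cosh x) ≤ |x| := by
  rw [Real.log_le_iff_le_exp (Real.cosh_pos x), Real.cosh_eq]
  linarith [Real.exp_le_exp.2 (le_abs_self x), Real.exp_le_exp.2 (neg_le_abs x)]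

lemma Real.abs_exp_sub_quadratic_le (x : ℝ) :
    |Real.exp x - (1 + x + x ^ 2 / 2)| ≤ |x| ^ 3 * Real.exp |x| := by
  have h := Complex.norm_exp_sub_sum_le_norm_mul_exp (x : ℂ) 3
  have e : Complex.exp x - ∑ m ∈ Finset.range 3, (x : ℂ) ^ m / (m.factorial : ℂ)
      = ((Real.exp x - (1 + x + x ^ 2 / 2) : ℝ) : ℂ) := by
    simp [Finset.sum_range_succ]
  rwa [e, Complex.norm_real, Complex.norm_real, Real.norm_eq_abs, Real.norm_eq_abs] at h

lemma integrable_exp_mul_abs_gaussianReal (t : ℝ) :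
    Integrable (fun x : ℝ ↦ Real.exp (t * |x|)) (gaussianReal 0 1) :=
  integrable_exp_mul_abs (integrable_exp_mul_gaussianReal t) (integrable_exp_mul_gaussianReal (-t))

lemma integrable_pow_gaussianReal (n : ℕ) :
    Integrable (fun x : ℝ ↦ x ^ n) (gaussianReal 0 1) := by
  simpa using integrable_pow_of_mem_interior_integrableExpSet (X := id) (μ := gaussianReal 0 1)
    (by simp) n

lemma integral_pow_gaussianReal (n : ℕ) :
    ∫ x : ℝ, x ^ n ∂(gaussianReal 0 1) = iteratedDeriv n (fun t ↦ Real.exp (t ^ 2 / 2)) 0 := by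
  have h := iteratedDeriv_mgf_zero (X := id) (μ := gaussianReal 0 1)
    (by simp) n
  rw [mgf_id_gaussianReal] at h
  simpa using h.symm

lemma deriv_mul_exp_half_sq {p q : ℝ → ℝ} (h : ∀ x, HasDerivAt p (q x) x) :
    deriv (fun t ↦ p t * Real.exp (t ^ 2 / 2))
      = fun t ↦ (q t + t * p t) * Real.exp (t ^ 2 / 2) := by
  ext t
  rw [((h t).fun_mul ((hasDerivAt_pow 2 t).div_const 2).exp).deriv]
  norm_num
  ring

lemma iteratedDeriv_two_exp_half_sq :
    iteratedDeriv 2 (fun t : ℝ ↦ Real.exp (t ^ 2 / 2))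
      = fun t ↦ (1 + t ^ 2) * Real.exp (t ^ 2 / 2) := by
  have h₁ := deriv_mul_exp_half_sq (fun x ↦ hasDerivAt_const x (1 : ℝ))
  have h₂ := deriv_mul_exp_half_sq (fun x ↦ hasDerivAt_id x)
  simp only [one_mul, zero_add, mul_one, id_eq] at h₁ h₂
  rw [iteratedDeriv_succ, iteratedDeriv_one, h₁, h₂]
  ext t; ring

lemma iteratedDeriv_four_exp_half_sq :
    iteratedDeriv 4 (fun t : ℝ ↦ Real.exp (t ^ 2 / 2))
      = fun t ↦ (3 + 6 * t ^ 2 + t ^ 4) * Real.exp (t ^ 2 / 2) := by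
  have h₁ := deriv_mul_exp_half_sq (fun x ↦ (hasDerivAt_const x (1 : ℝ)).add (hasDerivAt_pow 2 x))
  have h₂ := deriv_mul_exp_half_sq
    (fun x ↦ ((hasDerivAt_id x).const_mul (3 : ℝ)).add (hasDerivAt_pow 3 x))
  rw [iteratedDeriv_succ, iteratedDeriv_succ, iteratedDeriv_two_exp_half_sq]
  have e : (fun t : ℝ ↦ (1 + t ^ 2) * Real.exp (t ^ 2 / 2)) =
    (fun t ↦ ((fun _ ↦ (1 : ℝ)) + fun x : ℝ ↦ x ^ 2 : ℝ → ℝ) t * Real.exp (t ^ 2 / 2)) := rfl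
  rw [e, h₁]
  refine Eq.trans (congrArg deriv ?_) (h₂.trans ?_)
  · ext t; simp; ring
  · ext t; simp; ring

lemma integral_sq_gaussianReal : ∫ x : ℝ, x ^ 2 ∂(gaussianReal 0 1) = 1 := by
  simp [integral_pow_gaussianReal, iteratedDeriv_two_exp_half_sq]

lemma integral_pow_four_gaussianReal : ∫ x : ℝ, x ^ 4 ∂(gaussianReal 0 1) = 3 := by
  simp [integral_pow_gaussianReal, iteratedDeriv_four_exp_half_sq]

lemma integrable_exp_mul_log_cosh_gaussianReal {lam : ℝ} (hlam : 0 ≤ lam) (u c d : ℝ) :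
    Integrable (fun x : ℝ ↦ Real.exp (lam * (Real.log (Real.cosh (u * x)) - c + d)))
      (gaussianReal 0 1) := by
  refine ((integrable_exp_mul_abs_gaussianReal (lam * |u|)).mul_const
    (Real.exp (lam * (d - c)))).mono' ?_ (Filter.Eventually.of_forall fun x ↦ ?_)
  · have hc : Continuous fun x : ℝ ↦ Real.log (Real.cosh (u * x)) :=
      (Real.continuous_cosh.comp (continuous_const.mul continuous_id)).log
        fun x ↦ (Real.cosh_pos _).ne'
    exact Continuous.aestronglyMeasurable (by fun_prop)
  · rw [Real.norm_eq_abs, Real.abs_exp, ← Real.exp_add, Real.exp_le_exp]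
    have h := mul_le_mul_of_nonneg_left (Real.log_cosh_le_abs (u * x)) hlam
    rw [abs_mul] at h
    linarith

lemma Real.one_add_sq_pow_four_le (x : ℝ) : (1 + x ^ 2) ^ 4 ≤ 16 * Real.exp (4 * |x|) := by
  have h := Real.quadratic_le_exp_of_nonneg (abs_nonneg x)
  rw [sq_abs] at h
  have h' : 1 + x ^ 2 ≤ 2 * Real.exp |x| := by linarith [abs_nonneg x]
  calc (1 + x ^ 2) ^ 4 ≤ (2 * Real.exp |x|) ^ 4 := pow_le_pow_left₀ (by positivity) h' 4
    _ = 16 * Real.exp (4 * |x|) := by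
      rw [mul_pow, ← Real.exp_nat_mul]; norm_num

lemma abs_exp_mul_log_cosh_sub_expansion_le {lam u : ℝ} (hlam : 0 ≤ lam) (hu : |u| ≤ 1) (x : ℝ) :
    |Real.exp (lam * (Real.log (Real.cosh (u * x)) - u ^ 2 / 2 + u ^ 4 / 4))
        - (1 + lam * (u ^ 2 * (x ^ 2 - 1) / 2 + u ^ 4 * (1 / 4 - x ^ 4 / 12))
          + lam ^ 2 * u ^ 4 * (x ^ 2 - 1) ^ 2 / 8)|
      ≤ 16 * (lam + lam ^ 2 + lam ^ 3) * Real.exp lam * u ^ 6 * Real.exp ((lam + 4) * |x|) := by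
  set L := Real.log (Real.cosh (u * x)) with hL
  set D := L - u ^ 2 / 2 + u ^ 4 / 4 with hD
  set A := u ^ 2 * (x ^ 2 - 1) / 2 with hA
  set s := 1 + x ^ 2 with hs
  have hs1 : 1 ≤ s := by nlinarith [sq_nonneg x]
  have hxs : x ^ 2 ≤ s := by linarith
  have hu2 : u ^ 2 ≤ 1 := by rw [← sq_abs]; exact pow_le_one₀ (abs_nonneg u) hu
  have hu2n := sq_nonneg u
  have hu42 : u ^ 4 ≤ u ^ 2 := by nlinarith
  have hu4n : 0 ≤ u ^ 4 := by positivity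
  have hu6n : 0 ≤ u ^ 6 := by positivity
  have hx2 : u ^ 2 * x ^ 2 ≤ u ^ 2 * s := mul_le_mul_of_nonneg_left hxs hu2n
  have hus : u ^ 2 ≤ u ^ 2 * s := le_mul_of_one_le_right hu2n hs1
  have hx2n : 0 ≤ u ^ 2 * x ^ 2 := by positivity
  have hL0 : 0 ≤ L := Real.log_cosh_nonneg _
  have hL1 : L ≤ u ^ 2 * x ^ 2 / 2 := by
    rw [← mul_pow]; exact Real.log_cosh_le_half_sq _
  have hL2 : L ≤ |x| := (Real.log_cosh_le_abs _).trans <| by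
    rw [abs_mul]; exact mul_le_of_le_one_left (abs_nonneg x) hu
  have hL3 : |L - u ^ 2 * x ^ 2 / 2 + u ^ 4 * x ^ 4 / 12| ≤ u ^ 6 * x ^ 6 / 45 := by
    rw [← mul_pow, ← mul_pow, ← mul_pow]; exact Real.abs_log_cosh_sub_taylor_le _
  have hs34 : s ^ 3 ≤ s ^ 4 := pow_le_pow_right₀ hs1 (by norm_num)
  have hs13 : 1 ≤ s ^ 3 := one_le_pow₀ hs1
  have hx6 : x ^ 6 ≤ s ^ 3 := by
    calc x ^ 6 = (x ^ 2) ^ 3 := by ring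
      _ ≤ s ^ 3 := pow_le_pow_left₀ (sq_nonneg x) hxs 3
  have hx4 : x ^ 4 ≤ s ^ 3 := by
    calc x ^ 4 = (x ^ 2) ^ 2 := by ring
      _ ≤ s ^ 2 := pow_le_pow_left₀ (sq_nonneg x) hxs 2
      _ ≤ s ^ 3 := pow_le_pow_right₀ hs1 (by norm_num)
  have hDs : |D| ≤ u ^ 2 * s := by
    rw [abs_le]; constructor <;> linarith
  have hAs : |A| ≤ u ^ 2 * s := by
    rw [abs_le]; constructor <;> linarith
  have hDx : |D| ≤ 1 + |x| := by
    rw [abs_le]; constructor <;> linarith [abs_nonneg x]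
  have hlin : |D - (A + u ^ 4 * (1 / 4 - x ^ 4 / 12))| ≤ u ^ 6 * s ^ 4 := by
    have e : D - (A + u ^ 4 * (1 / 4 - x ^ 4 / 12))
        = L - u ^ 2 * x ^ 2 / 2 + u ^ 4 * x ^ 4 / 12 := by rw [hD, hA]; ring
    rw [e]
    have := mul_le_mul_of_nonneg_left (hx6.trans hs34) hu6n
    have : 0 ≤ u ^ 6 * x ^ 6 := by positivity
    linarith
  have hDA : |D - A| ≤ u ^ 4 * s ^ 3 := by
    have e : D - A = (L - u ^ 2 * x ^ 2 / 2 + u ^ 4 * x ^ 4 / 12)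
        + u ^ 4 * (1 / 4 - x ^ 4 / 12) := by rw [hD, hA]; ring
    have h64 : u ^ 6 * x ^ 6 ≤ u ^ 4 * s ^ 3 := by
      refine mul_le_mul ?_ hx6 (by positivity) hu4n
      calc u ^ 6 = u ^ 4 * u ^ 2 := by ring
        _ ≤ u ^ 4 := mul_le_of_le_one_right hu4n hu2
    have h44 := mul_le_mul_of_nonneg_left hx4 hu4n
    have h40 := mul_le_mul_of_nonneg_left hs13 hu4n
    have : 0 ≤ u ^ 4 * x ^ 4 := by positivity
    rw [e, abs_le]
    rw [abs_le] at hL3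
    constructor <;> linarith
  have hquad : |D ^ 2 - A ^ 2| ≤ 2 * (u ^ 6 * s ^ 4) := by
    have e : D ^ 2 - A ^ 2 = (D - A) * (D + A) := by ring
    rw [e, abs_mul]
    calc |D - A| * |D + A| ≤ (u ^ 4 * s ^ 3) * (u ^ 2 * s + u ^ 2 * s) :=
          mul_le_mul hDA ((abs_add_le D A).trans (add_le_add hDs hAs)) (abs_nonneg _)
            (by positivity)
      _ = 2 * (u ^ 6 * s ^ 4) := by ring
  have hexp : |Real.exp (lam * D) - (1 + lam * D + (lam * D) ^ 2 / 2)|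
      ≤ lam ^ 3 * (u ^ 6 * s ^ 4) * Real.exp (lam + lam * |x|) := by
    refine (Real.abs_exp_sub_quadratic_le _).trans ?_
    rw [abs_mul, abs_of_nonneg hlam]
    have h1 : (lam * |D|) ^ 3 ≤ lam ^ 3 * (u ^ 6 * s ^ 4) := by
      rw [mul_pow]
      refine mul_le_mul_of_nonneg_left ?_ (by positivity)
      calc |D| ^ 3 ≤ (u ^ 2 * s) ^ 3 := pow_le_pow_left₀ (abs_nonneg D) hDs 3
        _ = u ^ 6 * s ^ 3 := by ring
        _ ≤ u ^ 6 * s ^ 4 := mul_le_mul_of_nonneg_left hs34 hu6n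
    refine mul_le_mul h1 (Real.exp_le_exp.2 ?_) (Real.exp_pos _).le (by positivity)
    linarith [mul_le_mul_of_nonneg_left hDx hlam]
  set E := Real.exp (lam + lam * |x|) with hE
  have hE1 : 1 ≤ E := Real.one_le_exp (by positivity)
  have hsum : |Real.exp (lam * D) - (1 + lam * (A + u ^ 4 * (1 / 4 - x ^ 4 / 12))
          + lam ^ 2 * u ^ 4 * (x ^ 2 - 1) ^ 2 / 8)|
      ≤ lam ^ 3 * (u ^ 6 * s ^ 4) * E + lam * (u ^ 6 * s ^ 4) + lam ^ 2 * (u ^ 6 * s ^ 4) := by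
    have e : Real.exp (lam * D) - (1 + lam * (A + u ^ 4 * (1 / 4 - x ^ 4 / 12))
          + lam ^ 2 * u ^ 4 * (x ^ 2 - 1) ^ 2 / 8)
        = (Real.exp (lam * D) - (1 + lam * D + (lam * D) ^ 2 / 2))
          + lam * (D - (A + u ^ 4 * (1 / 4 - x ^ 4 / 12)))
          + lam ^ 2 / 2 * (D ^ 2 - A ^ 2) := by rw [hA]; ring
    rw [e]
    refine (abs_add_three _ _ _).trans (add_le_add (add_le_add hexp ?_) ?_)
    · rw [abs_mul, abs_of_nonneg hlam]
      exact mul_le_mul_of_nonneg_left hlin hlam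
    · rw [abs_mul, abs_of_nonneg (by positivity)]
      linarith [mul_le_mul_of_nonneg_left hquad (by positivity : 0 ≤ lam ^ 2 / 2)]
  have hW : 0 ≤ u ^ 6 * s ^ 4 := by positivity
  calc _ ≤ lam ^ 3 * (u ^ 6 * s ^ 4) * E + lam * (u ^ 6 * s ^ 4) + lam ^ 2 * (u ^ 6 * s ^ 4) :=
        hsum
    _ ≤ lam ^ 3 * (u ^ 6 * s ^ 4) * E + lam * (u ^ 6 * s ^ 4) * E
        + lam ^ 2 * (u ^ 6 * s ^ 4) * E := by
      have h1 := le_mul_of_one_le_right (mul_nonneg hlam hW) hE1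
      have h2 := le_mul_of_one_le_right (mul_nonneg (sq_nonneg lam) hW) hE1
      linarith
    _ = (lam + lam ^ 2 + lam ^ 3) * u ^ 6 * E * s ^ 4 := by ring
    _ ≤ (lam + lam ^ 2 + lam ^ 3) * u ^ 6 * E * (16 * Real.exp (4 * |x|)) :=
      mul_le_mul_of_nonneg_left (Real.one_add_sq_pow_four_le x) (by positivity)
    _ = 16 * (lam + lam ^ 2 + lam ^ 3) * Real.exp lam * u ^ 6 * Real.exp ((lam + 4) * |x|) := by
      rw [hE, Real.exp_add, add_mul lam 4 |x|, Real.exp_add]; ring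

lemma integrable_and_integral_quartic_gaussianReal (a b c : ℝ) :
    Integrable (fun x : ℝ ↦ a + b * x ^ 2 + c * x ^ 4) (gaussianReal 0 1) ∧
      ∫ x : ℝ, (a + b * x ^ 2 + c * x ^ 4) ∂(gaussianReal 0 1) = a + b + 3 * c := by
  have h0 : Integrable (fun _ : ℝ ↦ a) (gaussianReal 0 1) := integrable_const a
  have h2 := (integrable_pow_gaussianReal 2).const_mul b
  have h4 := (integrable_pow_gaussianReal 4).const_mul c
  have h02 : Integrable (fun x : ℝ ↦ a + b * x ^ 2) (gaussianReal 0 1) := h0.add h2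
  refine ⟨h02.add h4, ?_⟩
  rw [integral_add h02 h4, integral_add h0 h2, integral_const_mul, integral_const_mul,
    integral_sq_gaussianReal, integral_pow_four_gaussianReal]
  simp
  ring

lemma exists_abs_integral_exp_log_cosh_sub_le {lam : ℝ} (hlam : 0 ≤ lam) :
    ∃ K ≥ (0 : ℝ), ∀ u : ℝ, |u| ≤ 1 →
      |(∫ x : ℝ, Real.exp (lam * (Real.log (Real.cosh (u * x)) - u ^ 2 / 2 + u ^ 4 / 4))
          ∂(gaussianReal 0 1)) - (1 + lam ^ 2 * u ^ 4 / 4)| ≤ K * u ^ 6 := by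
  refine ⟨16 * (lam + lam ^ 2 + lam ^ 3) * Real.exp lam
    * ∫ x : ℝ, Real.exp ((lam + 4) * |x|) ∂(gaussianReal 0 1),
    mul_nonneg (by positivity) (integral_nonneg fun x ↦ (Real.exp_pos _).le), fun u hu ↦ ?_⟩
  obtain ⟨hint, hval⟩ := integrable_and_integral_quartic_gaussianReal
    (1 - lam * u ^ 2 / 2 + lam * u ^ 4 / 4 + lam ^ 2 * u ^ 4 / 8)
    (lam * u ^ 2 / 2 - lam ^ 2 * u ^ 4 / 4) (-(lam * u ^ 4 / 12) + lam ^ 2 * u ^ 4 / 8)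
  have hval' : 1 + lam ^ 2 * u ^ 4 / 4 = _ := Eq.trans (by ring) hval.symm
  rw [hval', ← integral_sub (integrable_exp_mul_log_cosh_gaussianReal hlam u _ _) hint,
    ← Real.norm_eq_abs]
  refine (norm_integral_le_of_norm_le
    ((integrable_exp_mul_abs_gaussianReal (lam + 4)).const_mul
      (16 * (lam + lam ^ 2 + lam ^ 3) * Real.exp lam * u ^ 6))
    (Filter.Eventually.of_forall fun x ↦ ?_)).trans_eq ?_
  · rw [Real.norm_eq_abs]
    convert abs_exp_mul_log_cosh_sub_expansion_le hlam hu x using 3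
    ring
  · rw [integral_const_mul]; ring

lemma Real.abs_log_one_add_sub_self_le {t : ℝ} (ht : |t| ≤ 1 / 2) :
    |Real.log (1 + t) - t| ≤ 2 * t ^ 2 := by
  have h := abs_le.1 ht
  have hpos : 0 < 1 + t := by linarith
  have h1 := Real.log_le_sub_one_of_pos hpos
  have h2 := Real.one_sub_inv_le_log_of_pos hpos
  have h3 : t - 2 * t ^ 2 ≤ 1 - (1 + t)⁻¹ := by
    have e : 1 - (1 + t)⁻¹ - (t - 2 * t ^ 2) = t ^ 2 * (1 + 2 * t) / (1 + t) := by
      field_simp; ring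
    have : 0 ≤ t ^ 2 * (1 + 2 * t) / (1 + t) :=
      div_nonneg (mul_nonneg (sq_nonneg t) (by linarith)) hpos.le
    linarith
  rw [abs_le]
  constructor <;> nlinarith [sq_nonneg t]

/-- Core estimate of Lemma 6.2 of the paper: for fixed `λ ≥ 0` and
`F(u) = E[exp(λ(log cosh(uη) - u²/2 + u⁴/4))]` with `η` standard Gaussian,
`F(u) > 0` and `log F(u) = λ²u⁴/4 + O(u⁶)` as `u → 0`. -/
theorem log_mgf_log_cosh_estimate (lam : ℝ) (hlam : 0 ≤ lam) :
    (∀ u : ℝ,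
      0 < ∫ x : ℝ, Real.exp (lam * (Real.log (Real.cosh (u * x)) - u ^ 2 / 2 + u ^ 4 / 4))
            ∂(gaussianReal 0 1)) ∧
    ∃ C > (0 : ℝ), ∃ δ > (0 : ℝ), ∀ u : ℝ, |u| ≤ δ →
      |Real.log (∫ x : ℝ,
            Real.exp (lam * (Real.log (Real.cosh (u * x)) - u ^ 2 / 2 + u ^ 4 / 4))
            ∂(gaussianReal 0 1))
          - lam ^ 2 * u ^ 4 / 4| ≤ C * u ^ 6 := by
  refine ⟨fun u ↦ integral_exp_pos (integrable_exp_mul_log_cosh_gaussianReal hlam u _ _), ?_⟩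
  obtain ⟨K, hK, hF⟩ := exists_abs_integral_exp_log_cosh_sub_le hlam
  set N := lam ^ 2 / 4 + K with hN
  have hN0 : 0 ≤ N := by positivity
  refine ⟨K + 2 * N ^ 2 + 1, by positivity, min 1 (1 / (2 * (N + 1))), by positivity,
    fun u hu ↦ ?_⟩
  have hu1 : |u| ≤ 1 := hu.trans (min_le_left _ _)
  have hu2 : |u| ≤ 1 / (2 * (N + 1)) := hu.trans (min_le_right _ _)
  specialize hF u hu1
  set F := ∫ x : ℝ, Real.exp (lam * (Real.log (Real.cosh (u * x)) - u ^ 2 / 2 + u ^ 4 / 4))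
    ∂(gaussianReal 0 1)
  have hp (m n : ℕ) (hm : Even m) (hn : Even n) (hmn : m ≤ n) : u ^ n ≤ u ^ m := by
    rw [← hn.pow_abs, ← hm.pow_abs]
    exact pow_le_pow_of_le_one (abs_nonneg u) hu1 hmn
  have h64 : u ^ 6 ≤ u ^ 4 := hp 4 6 (by decide) (by decide) (by norm_num)
  have h86 : u ^ 8 ≤ u ^ 6 := hp 6 8 (by decide) (by decide) (by norm_num)
  have hu6 : 0 ≤ u ^ 6 := by positivity
  have h41 : u ^ 4 ≤ |u| := by
    rw [← (by decide : Even 4).pow_abs]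
    exact pow_le_of_le_one (abs_nonneg u) hu1 (by norm_num)
  have hF' := abs_le.1 hF
  have hK64 := mul_le_mul_of_nonneg_left h64 hK
  have ht : |F - 1| ≤ N * u ^ 4 := by
    have : 0 ≤ lam ^ 2 * u ^ 4 := by positivity
    rw [hN, abs_le]
    constructor <;> linarith
  have ht' : |F - 1| ≤ 1 / 2 := by
    calc |F - 1| ≤ N * u ^ 4 := ht
      _ ≤ (N + 1) * (1 / (2 * (N + 1))) :=
        mul_le_mul (by linarith) (h41.trans hu2) (by positivity) (by positivity)
      _ = 1 / 2 := by field_simp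
  have hlog := Real.abs_log_one_add_sub_self_le ht'
  rw [add_sub_cancel] at hlog
  have hsq : (F - 1) ^ 2 ≤ N ^ 2 * u ^ 6 := by
    calc (F - 1) ^ 2 = |F - 1| ^ 2 := (sq_abs _).symm
      _ ≤ (N * u ^ 4) ^ 2 := pow_le_pow_left₀ (abs_nonneg _) ht 2
      _ = N ^ 2 * u ^ 8 := by ring
      _ ≤ N ^ 2 * u ^ 6 := mul_le_mul_of_nonneg_left h86 (sq_nonneg N)
  have hlog' := abs_le.1 hlog
  rw [abs_le]
  constructor <;> linarith
end

section
/- Fix s ≥ 0 and τ > 0; let σ_0 = 1 and σ_k = |k|^s for k ≠ 0, and let Σ(τ,r) = { θ ∈ ℓ²(ℤ) : (2π)^{2τ} ∑_{k∈ℤ} |k|^{2τ} θ_k² ≤ 1 and ∑_{k∈ℤ} θ_k² ≥ r² }. For ε, r > 0 let a(ε,r) = ε^{−2} · sup{ inf{ ∑_k w_k θ_k²/σ_k² : θ ∈ Σ(τ,r) } : w ∈ ℓ²(ℤ), w_k ≥ 0, ∑_k w_k² = 1/2 }. For positive integers M, N, m, n with m ≤ M, n ≤ N, and an array θ̄ =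 (θ_{ij,k})_{(i,j,k)∈Fin M×Fin N×ℤ}, say θ̄ ∈ Θ(ε,r,M,N,m,n) if there exist A ⊆ Fin M with card A = m and B ⊆ Fin N with card B = n such that θ_{ij,·} = 0 for (i,j) ∉ A×B and θ_{ij,·} ∈ Σ(τ,r) for (i,j) ∈ A×B. Let P_{θ̄} be the infinite product over (i,j,k) ∈ Fin M×Fin N×ℤ of Gaussian measures with mean θ_{ij,k} and variance ε²σ_k², and P₀ = P_{0}. Now let ε_j → 0⁺, let m_j, n_j, M_j, N_j → ∞ with p_j := m_j/M_j → 0 and q_j := n_j/N_j → 0, let r_j → 0⁺, and set a_j = a(ε_j, r_j) and D_j = m_j·log(1/p_j) + n_j·log(1/q_j). If either (i) a_j²·m_j n_j p_j q_j → ∞, or (ii) liminf_j a_j²·m_j n_j/(2 D_j) > 1 and D_j·r_j^{1/τ}/(m_j n_j) → 0, then there exists a sequence of measurable functions ψ_j : ℝ^{Fin M_j×Fin N_j×ℤ} → [0,1] such that ∫ ψ_j dP₀ + sup{ ∫ (1−ψ_j) dP_{θ̄} : θ̄ ∈ Θ(ε_j,r_j,M_j,N_j,m_j,n_j) } → 0.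 -/
open MeasureTheory ProbabilityTheory Filter
open scoped BigOperators ENNReal

noncomputable section

/-- The Sobolev ellipsoid with energy constraint:
`Σ(τ,r) = {θ ∈ ℓ²(ℤ) : (2π)^{2τ} ∑_k |k|^{2τ}θ_k² ≤ 1, ∑_k θ_k² ≥ r²}`. -/
def SobolevBall (τ r : ℝ) : Set (ℤ → ℝ) :=
  {θ | Summable (fun k : ℤ => (θ k) ^ 2) ∧
    Summable (fun k : ℤ => |(k : ℝ)| ^ (2 * τ) * (θ k) ^ 2) ∧
    (2 * Real.pi) ^ (2 * τ) * (∑' k : ℤ, |(k : ℝ)| ^ (2 * τ) * (θ k) ^ 2) ≤ 1 ∧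
    r ^ 2 ≤ ∑' k : ℤ, (θ k) ^ 2}

/-- The quantity `a(ε,r) = ε^{-2}·sup_w inf_{θ∈Σ(τ,r)} ∑_k w_k θ_k²/σ_k²`, where the
supremum is over nonnegative `w ∈ ℓ²(ℤ)` with `∑_k w_k² = 1/2`. -/
def sepRate (s τ ε r : ℝ) : ℝ :=
  ε ^ (-(2 : ℝ)) *
    sSup {x : ℝ | ∃ w : ℤ → ℝ, Summable (fun k : ℤ => (w k) ^ 2) ∧ (∀ k, 0 ≤ w k) ∧
      (∑' k : ℤ, (w k) ^ 2) = 1 / 2 ∧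
      x = sInf {y : ℝ | ∃ θ ∈ SobolevBall τ r,
        y = ∑' k : ℤ, w k * (θ k) ^ 2 / (sigmaSeq s k) ^ 2}}

/-- Membership in the alternative `Θ(ε,r,M,N,m,n)`: there is an `m×n` submatrix `A×B`
outside of which all signals vanish and inside of which every signal lies in `Σ(τ,r)`. -/
def InAlt (τ r : ℝ) (M N m n : ℕ) (θ : Fin M → Fin N → ℤ → ℝ) : Prop :=
  ∃ A : Finset (Fin M), A.card = m ∧ ∃ B : Finset (Fin N), B.card = n ∧
    (∀ i j, ¬(i ∈ A ∧ j ∈ B) → ∀ k, θ i j k = 0) ∧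
    (∀ i ∈ A, ∀ j ∈ B, (fun k => θ i j k) ∈ SobolevBall τ r)

/-- `P` is the infinite product over `(i,j,k) ∈ Fin M × Fin N × ℤ` of the Gaussian
measures `N(θ_{ij,k}, ε²σ_k²)`: a probability measure whose finite-dimensional
projections are the corresponding finite Gaussian product measures. -/
def IsGaussianProductMeasure (s ε : ℝ) {M N : ℕ} (θ : Fin M → Fin N → ℤ → ℝ)
    (P : Measure (Fin M × Fin N × ℤ → ℝ)) : Prop :=
  IsProbabilityMeasure P ∧
    IsProjectiveLimit P
      (fun F : Finset (Fin M × Fin N × ℤ) =>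
        Measure.pi fun p : F =>
          gaussianReal (θ (p : Fin M × Fin N × ℤ).1 (p : Fin M × Fin N × ℤ).2.1
              (p : Fin M × Fin N × ℤ).2.2)
            (Real.toNNReal (ε ^ 2 * (sigmaSeq s (p : Fin M × Fin N × ℤ).2.2) ^ 2)))

/-- A standardized Gaussian variable has an explicit exponential quadratic moment. -/
lemma gaussianReal_exp_mul_sq (μ l : ℝ) (hl : 2 * l < 1) :
    Integrable (fun y => Real.exp (l * y ^ 2)) (gaussianReal μ 1) ∧
    ∫ y, Real.exp (l * y ^ 2) ∂(gaussianReal μ 1) =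
      (√(1 - 2 * l))⁻¹ * Real.exp (l * μ ^ 2 / (1 - 2 * l)) := by
  have hd : 0 < 1 - 2 * l := by linarith
  obtain ⟨v, hv⟩ : ∃ v : NNReal, (v : ℝ) = (1 - 2 * l)⁻¹ := ⟨⟨(1 - 2 * l)⁻¹, by positivity⟩, rfl⟩
  have hv0 : v ≠ 0 := by
    intro h
    rw [h] at hv
    have : 0 < (1 - 2 * l)⁻¹ := by positivity
    simp only [NNReal.coe_zero] at hv
    linarith
  have key : ∀ y, gaussianPDFReal μ 1 y * Real.exp (l * y ^ 2) =
      ((√(1 - 2 * l))⁻¹ * Real.exp (l * μ ^ 2 / (1 - 2 * l))) *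
        gaussianPDFReal (μ / (1 - 2 * l)) v y := by
    intro y
    simp only [gaussianPDFReal, hv, NNReal.coe_one, mul_one]
    have h1 : √(2 * Real.pi * (1 - 2 * l)⁻¹) = √(2 * Real.pi) * (√(1 - 2 * l))⁻¹ := by
      rw [Real.sqrt_mul (by positivity), Real.sqrt_inv]
    have h2 : √(1 - 2 * l) ≠ 0 := (Real.sqrt_pos.2 hd).ne'
    have h3 : √(2 * Real.pi) ≠ 0 := (Real.sqrt_pos.2 (by positivity)).ne'
    rw [h1, mul_assoc, ← Real.exp_add]
    rw [show (√(1 - 2 * l))⁻¹ * Real.exp (l * μ ^ 2 / (1 - 2 * l)) *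
        ((√(2 * Real.pi) * (√(1 - 2 * l))⁻¹)⁻¹ *
          Real.exp (-(y - μ / (1 - 2 * l)) ^ 2 / (2 * (1 - 2 * l)⁻¹))) =
        (√(2 * Real.pi))⁻¹ * (Real.exp (l * μ ^ 2 / (1 - 2 * l)) *
          Real.exp (-(y - μ / (1 - 2 * l)) ^ 2 / (2 * (1 - 2 * l)⁻¹))) by field_simp,
      ← Real.exp_add]
    congr 2
    field_simp
    ring
  constructor
  · rw [gaussianReal_of_var_ne_zero _ one_ne_zero,
      integrable_withDensity_iff_integrable_smul' (measurable_gaussianPDF μ 1)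
        (ae_of_all _ fun _ => gaussianPDF_lt_top)]
    simp only [toReal_gaussianPDF, smul_eq_mul, key]
    exact (integrable_gaussianPDFReal _ _).const_mul _
  · rw [integral_gaussianReal_eq_integral_smul one_ne_zero]
    simp only [smul_eq_mul, key]
    rw [integral_const_mul, integral_gaussianPDFReal_eq_one _ hv0, mul_one]

lemma gaussianReal_mgf_centered_sq (μ c t : ℝ) (h : 2 * (t * c) < 1) :
    Integrable (fun y => Real.exp (t * (c * (y ^ 2 - 1)))) (gaussianReal μ 1) ∧
    mgf (fun y => c * (y ^ 2 - 1)) (gaussianReal μ 1) t =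
      Real.exp (-(t * c) - Real.log (1 - 2 * (t * c)) / 2 +
        t * c * μ ^ 2 / (1 - 2 * (t * c))) := by
  obtain ⟨h1, h2⟩ := gaussianReal_exp_mul_sq μ (t * c) h
  have e : (fun y : ℝ => Real.exp (t * (c * (y ^ 2 - 1)))) =
      fun y => Real.exp (-(t * c)) * Real.exp (t * c * y ^ 2) := by
    funext y; rw [← Real.exp_add]; congr 1; ring
  refine ⟨by rw [e]; exact h1.const_mul _, ?_⟩
  rw [mgf, e, integral_const_mul, h2, Real.exp_add, Real.exp_sub]
  have hd : 0 < 1 - 2 * (t * c) := by linarith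
  have : Real.exp (Real.log (1 - 2 * (t * c)) / 2) = √(1 - 2 * (t * c)) := by
    rw [Real.sqrt_eq_rpow, Real.rpow_def_of_pos hd]; congr 1; ring
  rw [this]
  field_simp

lemma neg_sub_log_le_sq_div {x w : ℝ} (hx : 0 ≤ x) (hxw : x ≤ w) (hw : 2 * w < 1) :
    -x - Real.log (1 - 2 * x) / 2 ≤ x ^ 2 / (1 - 2 * w) := by
  have hd : 0 < 1 - 2 * x := by linarith
  have h0 : 0 ≤ Real.log (1 - 2 * x)⁻¹ := Real.log_nonneg (by
    rw [one_le_inv₀ hd]; linarith)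
  have h1 := Real.self_le_sinh_iff.2 h0
  rw [Real.sinh_log (by positivity), Real.log_inv, inv_inv] at h1
  have h2 : x ^ 2 / (1 - 2 * x) ≤ x ^ 2 / (1 - 2 * w) := by
    apply div_le_div_of_nonneg_left (sq_nonneg x) (by linarith) (by linarith)
  have h3 : x ^ 2 / (1 - 2 * x) = -x + ((1 - 2 * x)⁻¹ - (1 - 2 * x)) / 2 / 2 := by
    rw [div_eq_mul_inv]
    linear_combination (-(1 + 2 * x) / 4) * inv_mul_cancel₀ hd.ne'
  linarith

lemma sub_log_le_sq {x : ℝ} (hx : 0 ≤ x) : x - Real.log (1 + 2 * x) / 2 ≤ x ^ 2 := by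
  have h := Real.le_log_one_add_of_nonneg (x := 2 * x) (by linarith)
  have : 2 * x - 2 * x ^ 2 ≤ 2 * (2 * x) / (2 * x + 2) := by
    rw [le_div_iff₀ (by linarith)]
    nlinarith [pow_nonneg hx 3]
  linarith

/-- Chernoff bound for the upper tail of a weighted sum of centred squares of independent
standard Gaussian variables. -/
lemma chernoff_upper {Ω ι : Type*} [MeasurableSpace Ω] {P : Measure Ω} [IsProbabilityMeasure P]
    {Y : ι → Ω → ℝ} (hY : ∀ p, Measurable (Y p)) (hind : iIndepFun Y P)
    (hlaw : ∀ p, P.map (Y p) = gaussianReal 0 1) (S : Finset ι) (c : ι → ℝ) (w l t : ℝ)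
    (hc : ∀ p, 0 ≤ c p) (hcw : ∀ p, c p ≤ w) (hl : 0 ≤ l) (hlw : 2 * (l * w) < 1) :
    P.real {x | t ≤ ∑ p ∈ S, c p * (Y p x ^ 2 - 1)} ≤
      Real.exp (-l * t + l ^ 2 * (∑ p ∈ S, c p ^ 2) / (1 - 2 * (l * w))) := by
  have hZ : ∀ p, Measurable (fun x => c p * (Y p x ^ 2 - 1)) := fun p =>
    (((hY p).pow_const 2).sub_const 1).const_mul _
  have hindZ : iIndepFun (fun p x => c p * (Y p x ^ 2 - 1)) P :=
    hind.comp (fun p y => c p * (y ^ 2 - 1)) (fun p => by fun_prop)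
  have hlc : ∀ p, l * c p ≤ l * w := fun p => mul_le_mul_of_nonneg_left (hcw p) hl
  have hm := fun p => gaussianReal_mgf_centered_sq 0 (c p) l (by linarith [hlc p])
  have hexp : ∀ p, Integrable (fun x => Real.exp (l * (c p * (Y p x ^ 2 - 1)))) P := fun p => by
    have := (hm p).1
    rw [← hlaw p] at this
    exact this.comp_measurable (hY p)
  have hI := hindZ.integrable_exp_mul_sum hZ (s := S) (t := l) (fun p _ => hexp p)
  have h1 := measure_ge_le_exp_mul_mgf (μ := P) t hl hI
  simp only [Finset.sum_apply] at h1
  refine h1.trans ?_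
  rw [Real.exp_add, hindZ.mgf_sum hZ]
  refine mul_le_mul_of_nonneg_left ?_ (Real.exp_pos _).le
  rw [Finset.mul_sum, Finset.sum_div, Real.exp_sum]
  refine Finset.prod_le_prod (fun p _ => mgf_nonneg) fun p _ => ?_
  have : mgf (fun x => c p * (Y p x ^ 2 - 1)) P l =
      mgf (fun y => c p * (y ^ 2 - 1)) (gaussianReal 0 1) l := by
    rw [← hlaw p, mgf_map (hY p).aemeasurable]
    · rfl
    · rw [hlaw p]; exact (hm p).1.aestronglyMeasurable
  rw [this, (hm p).2, Real.exp_le_exp]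
  have := neg_sub_log_le_sq_div (mul_nonneg hl (hc p)) (hlc p) hlw
  rw [mul_pow] at this
  simpa using this

/-- Chernoff bound for the lower tail of a weighted sum of centred squares of independent
Gaussian variables with unit variance. -/
lemma chernoff_lower {Ω ι : Type*} [MeasurableSpace Ω] {P : Measure Ω} [IsProbabilityMeasure P]
    {Y : ι → Ω → ℝ} {μ : ι → ℝ} (hY : ∀ p, Measurable (Y p)) (hind : iIndepFun Y P)
    (hlaw : ∀ p, P.map (Y p) = gaussianReal (μ p) 1) (S : Finset ι) (c : ι → ℝ) (w l t : ℝ)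
    (hc : ∀ p, 0 ≤ c p) (hcw : ∀ p, c p ≤ w) (hl : 0 ≤ l) :
    P.real {x | ∑ p ∈ S, c p * (Y p x ^ 2 - 1) ≤ t} ≤
      Real.exp (l * t + l ^ 2 * (∑ p ∈ S, c p ^ 2) -
        l * (∑ p ∈ S, c p * μ p ^ 2) / (1 + 2 * (l * w))) := by
  have hZ : ∀ p, Measurable (fun x => c p * (Y p x ^ 2 - 1)) := fun p =>
    (((hY p).pow_const 2).sub_const 1).const_mul _
  have hindZ : iIndepFun (fun p x => c p * (Y p x ^ 2 - 1)) P :=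
    hind.comp (fun p y => c p * (y ^ 2 - 1)) (fun p => by fun_prop)
  have hlc : ∀ p, l * c p ≤ l * w := fun p => mul_le_mul_of_nonneg_left (hcw p) hl
  have hlc0 : ∀ p, 0 ≤ l * c p := fun p => mul_nonneg hl (hc p)
  have hm := fun p => gaussianReal_mgf_centered_sq (μ p) (c p) (-l) (by linarith [hlc0 p])
  have hexp : ∀ p, Integrable (fun x => Real.exp (-l * (c p * (Y p x ^ 2 - 1)))) P := fun p => by
    have := (hm p).1
    rw [← hlaw p] at this
    exact this.comp_measurable (hY p)
  have hI := hindZ.integrable_exp_mul_sum hZ (s := S) (t := -l) (fun p _ => hexp p)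
  have h1 := measure_le_le_exp_mul_mgf (μ := P) t (neg_nonpos.2 hl) hI
  simp only [Finset.sum_apply] at h1
  refine h1.trans ?_
  rw [add_sub_assoc, Real.exp_add, hindZ.mgf_sum hZ, neg_neg]
  refine mul_le_mul_of_nonneg_left ?_ (Real.exp_pos _).le
  rw [Finset.mul_sum, Finset.mul_sum, Finset.sum_div, ← Finset.sum_sub_distrib, Real.exp_sum]
  refine Finset.prod_le_prod (fun p _ => mgf_nonneg) fun p _ => ?_
  have : mgf (fun x => c p * (Y p x ^ 2 - 1)) P (-l) =
      mgf (fun y => c p * (y ^ 2 - 1)) (gaussianReal (μ p) 1) (-l) := by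
    rw [← hlaw p, mgf_map (hY p).aemeasurable]
    · rfl
    · rw [hlaw p]; exact (hm p).1.aestronglyMeasurable
  rw [this, (hm p).2, Real.exp_le_exp]
  have h2 := sub_log_le_sq (hlc0 p)
  have h3 : l * (c p * μ p ^ 2) / (1 + 2 * (l * w)) ≤ l * (c p * μ p ^ 2) / (1 + 2 * (l * c p)) :=
    div_le_div_of_nonneg_left (mul_nonneg hl (mul_nonneg (hc p) (sq_nonneg _)))
      (by linarith [hlc0 p]) (by linarith [hlc p])
  have e1 : 1 - 2 * (-l * c p) = 1 + 2 * (l * c p) := by ring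
  have e2 : -l * c p * μ p ^ 2 / (1 + 2 * (l * c p)) =
      -(l * (c p * μ p ^ 2) / (1 + 2 * (l * c p))) := by ring
  rw [e1, e2]
  rw [mul_pow] at h2
  linarith

lemma sigmaSeq_pos (s : ℝ) (k : ℤ) : 0 < sigmaSeq s k := by
  unfold sigmaSeq
  split_ifs with h
  · exact one_pos
  · exact Real.rpow_pos_of_pos (by simpa using h) _

/-- The coordinates of the observation, divided by their standard deviations. -/
def stdCoord (s ε : ℝ) {M N : ℕ} (q : (Fin M × Fin N) × ℤ) (x : Fin M × Fin N × ℤ → ℝ) : ℝ :=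
  x (q.1.1, q.1.2, q.2) / (ε * sigmaSeq s q.2)

lemma measurable_stdCoord (s ε : ℝ) {M N : ℕ} (q : (Fin M × Fin N) × ℤ) :
    Measurable (stdCoord s ε q) :=
  (measurable_pi_apply _).div_const _

lemma IsGaussianProductMeasure.eq_infinitePi {s ε : ℝ} {M N : ℕ} {θ : Fin M → Fin N → ℤ → ℝ}
    {P : Measure (Fin M × Fin N × ℤ → ℝ)} (h : IsGaussianProductMeasure s ε θ P) :
    P = Measure.infinitePi fun p : Fin M × Fin N × ℤ =>
      gaussianReal (θ p.1 p.2.1 p.2.2) (Real.toNNReal (ε ^ 2 * (sigmaSeq s p.2.2) ^ 2)) :=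
  h.2.unique (Measure.isProjectiveLimit_infinitePi _)

lemma IsGaussianProductMeasure.iIndepFun_stdCoord {s ε : ℝ} {M N : ℕ}
    {θ : Fin M → Fin N → ℤ → ℝ} {P : Measure (Fin M × Fin N × ℤ → ℝ)}
    (h : IsGaussianProductMeasure s ε θ P) :
    iIndepFun (fun (q : (Fin M × Fin N) × ℤ) => stdCoord s ε q) P := by
  rw [h.eq_infinitePi]
  exact iIndepFun.precomp (g := Equiv.prodAssoc (Fin M) (Fin N) ℤ)
    (Equiv.prodAssoc (Fin M) (Fin N) ℤ).injective
    (iIndepFun_infinitePi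
      (X := fun (p : Fin M × Fin N × ℤ) (x : ℝ) => x / (ε * sigmaSeq s p.2.2))
      (fun p => measurable_id.div_const _))

lemma IsGaussianProductMeasure.map_stdCoord {s ε : ℝ} (hε : 0 < ε) {M N : ℕ}
    {θ : Fin M → Fin N → ℤ → ℝ} {P : Measure (Fin M × Fin N × ℤ → ℝ)}
    (h : IsGaussianProductMeasure s ε θ P) (q : (Fin M × Fin N) × ℤ) :
    P.map (stdCoord s ε q) =
      gaussianReal (θ q.1.1 q.1.2 q.2 / (ε * sigmaSeq s q.2)) 1 := by
  have hσ := sigmaSeq_pos s q.2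
  rw [h.eq_infinitePi]
  have e : (stdCoord s ε q) = (fun y : ℝ => y / (ε * sigmaSeq s q.2)) ∘
      fun x : Fin M × Fin N × ℤ → ℝ => x (q.1.1, q.1.2, q.2) := rfl
  rw [e, ← Measure.map_map (by fun_prop) (by fun_prop)]
  rw [Measure.infinitePi_map_eval, gaussianReal_map_div_const]
  congr 1
  apply NNReal.coe_injective
  simp only [NNReal.coe_div, NNReal.coe_mk, NNReal.coe_one]
  rw [Real.coe_toNNReal _ (by positivity), ← mul_pow]
  exact div_self (by positivity)

/-- Error bounds for the scan test that rejects when one of the normalized statistics of the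
blocks in `𝒮`, all of size `b`, exceeds the level `t`. -/
lemma exists_scan_test (s ε : ℝ) (hε : 0 < ε) {M N : ℕ} (𝒮 : Finset (Finset (Fin M × Fin N)))
    (b : ℝ) (hb0 : 0 < b) (hb : ∀ S ∈ 𝒮, (S.card : ℝ) = b) (F : Finset ℤ) (w : ℤ → ℝ) (ω : ℝ)
    (hw0 : ∀ k, 0 ≤ w k) (hwω : ∀ k, w k ≤ ω) (hsum : ∑ k ∈ F, w k ^ 2 = 1 / 2)
    (t l κ : ℝ) (hl : 0 ≤ l) (hκ : 0 ≤ κ) (hlω : 2 * (l * (ω / √b)) < 1) :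
    ∃ ψ : (Fin M × Fin N × ℤ → ℝ) → ℝ, Measurable ψ ∧ (∀ x, ψ x ∈ Set.Icc (0 : ℝ) 1) ∧
      (∀ P, IsGaussianProductMeasure s ε (fun _ _ _ => 0) P →
        ∫ x, ψ x ∂P ≤ 𝒮.card * Real.exp (-l * t + l ^ 2 / 2 / (1 - 2 * (l * (ω / √b))))) ∧
      (∀ θ P, IsGaussianProductMeasure s ε θ P → ∀ S ∈ 𝒮, ∀ e,
        e ≤ (∑ q ∈ S, ∑ k ∈ F, w k * θ q.1 q.2 k ^ 2 / sigmaSeq s k ^ 2) / (ε ^ 2 * √b) →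
        ∫ x, (1 - ψ x) ∂P ≤
          Real.exp (κ * t + κ ^ 2 / 2 - κ * e / (1 + 2 * (κ * (ω / √b))))) := by
  classical
  have hsb : 0 < √b := Real.sqrt_pos.2 hb0
  let c : (Fin M × Fin N) × ℤ → ℝ := fun q => w q.2 / √b
  have hc0 : ∀ q, 0 ≤ c q := fun q => div_nonneg (hw0 _) hsb.le
  have hcω : ∀ q, c q ≤ ω / √b := fun q => div_le_div_of_nonneg_right (hwω _) hsb.le
  have hcsum : ∀ S ∈ 𝒮, ∑ p ∈ S ×ˢ F, c p ^ 2 = 1 / 2 := by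
    intro S hS
    simp only [c, Finset.sum_product, div_pow, Real.sq_sqrt hb0.le]
    rw [← Finset.sum_div, hsum, Finset.sum_const, nsmul_eq_mul, hb S hS]
    field_simp
  let T : Finset (Fin M × Fin N) → (Fin M × Fin N × ℤ → ℝ) → ℝ := fun S x =>
    ∑ p ∈ S ×ˢ F, c p * (stdCoord s ε p x ^ 2 - 1)
  have hT : ∀ S, Measurable (T S) := fun S =>
    Finset.measurable_sum _ fun p _ =>
      (((measurable_stdCoord s ε p).pow_const 2).sub_const 1).const_mul _
  let E : Set (Fin M × Fin N × ℤ → ℝ) := ⋃ S ∈ 𝒮, {x | t ≤ T S x}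
  have hE : MeasurableSet E :=
    Finset.measurableSet_biUnion _ fun S _ => measurableSet_le measurable_const (hT S)
  refine ⟨E.indicator (fun _ => 1), measurable_const.indicator hE, fun x => ?_, fun P hP => ?_,
    fun θ P hP S hS e he => ?_⟩
  · by_cases hx : x ∈ E <;> simp [hx]
  · have := hP.1
    rw [integral_indicator_const _ hE, smul_eq_mul, mul_one]
    refine (measureReal_biUnion_finset_le _ _).trans ?_
    rw [← nsmul_eq_mul]
    refine Finset.sum_le_card_nsmul _ _ _ fun S hS => ?_
    have h1 := chernoff_upper (fun p => measurable_stdCoord s ε p) hP.iIndepFun_stdCoord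
      (fun p => by simpa using hP.map_stdCoord hε p) (S ×ˢ F) c (ω / √b) l t hc0 hcω hl hlω
    rw [hcsum S hS] at h1
    refine h1.trans_eq ?_
    ring_nf
  · have := hP.1
    have e1 : ∀ x, 1 - E.indicator (fun _ => (1 : ℝ)) x = Eᶜ.indicator (fun _ => (1 : ℝ)) x := fun x => by
      by_cases hx : x ∈ E <;> simp [hx]
    simp_rw [e1]
    rw [integral_indicator_const _ hE.compl, smul_eq_mul, mul_one]
    have hsub : Eᶜ ⊆ {x | T S x ≤ t} := by
      intro x hx
      by_contra hcon
      apply hx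
      simp only [Set.mem_ofPred_eq, not_le] at hcon
      exact Set.mem_biUnion hS hcon.le
    refine (measureReal_mono hsub).trans ?_
    refine (chernoff_lower (fun p => measurable_stdCoord s ε p) hP.iIndepFun_stdCoord
      (hP.map_stdCoord hε) (S ×ˢ F) c (ω / √b) κ t hc0 hcω hκ).trans ?_
    rw [hcsum S hS, Real.exp_le_exp]
    have h2 : (∑ q ∈ S, ∑ k ∈ F, w k * θ q.1 q.2 k ^ 2 / sigmaSeq s k ^ 2) / (ε ^ 2 * √b) =
        ∑ p ∈ S ×ˢ F, c p * (θ p.1.1 p.1.2 p.2 / (ε * sigmaSeq s p.2)) ^ 2 := by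
      rw [Finset.sum_product, Finset.sum_div]
      refine Finset.sum_congr rfl fun q _ => ?_
      rw [Finset.sum_div]
      refine Finset.sum_congr rfl fun k _ => ?_
      simp only [c]
      have := (sigmaSeq_pos s k).ne'
      field_simp
    rw [h2] at he
    have h3 : 0 ≤ κ * (ω / √b) := by
      obtain ⟨k⟩ : Nonempty ℤ := inferInstance
      exact mul_nonneg hκ (div_nonneg ((hw0 k).trans (hwω k)) hsb.le)
    have h4 := div_le_div_of_nonneg_right (mul_le_mul_of_nonneg_left he hκ)
      (show 0 ≤ 1 + 2 * (κ * (ω / √b)) by linarith)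
    linarith

lemma one_le_sigmaSeq {s : ℝ} (hs : 0 ≤ s) (k : ℤ) : 1 ≤ sigmaSeq s k := by
  unfold sigmaSeq
  split_ifs with h
  · exact le_rfl
  · refine Real.one_le_rpow ?_ hs
    exact_mod_cast Int.one_le_abs h

/-- There is a water level `A` at which the truncated weights `ρ k * (A - b k)₊` have
`b`-barycentre equal to a prescribed `R`. -/
lemma exists_water_level (b ρ : ℤ → ℝ) (hρ : ∀ k, 1 ≤ ρ k)
    (hfin : ∀ A : ℝ, {k | b k < A}.Finite) (R : ℝ) :
    ∃ A, R ≤ A ∧ ∃ F : Finset ℤ, (∀ k ∉ F, A ≤ b k) ∧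
      ∑ k ∈ F, ρ k * max (A - b k) 0 * (b k - R) = 0 := by
  classical
  let H : Finset ℤ := (hfin (R + 1)).toFinset
  have hH : ∀ k, k ∉ H → R + 1 ≤ b k := fun k hk => by simpa [H] using hk
  obtain ⟨c, hc⟩ := exists_nat_ge (-∑ k ∈ H, ρ k * (b k - R) + 1)
  obtain ⟨G, hGs, hGc⟩ := (hfin (R + 1)).infinite_compl.exists_subset_card_eq c
  have hGH : Disjoint H G := by
    rw [Finset.disjoint_left]
    intro k hk hkG
    exact hGs hkG (by simpa [H] using hk)
  let F₀ := H ∪ G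
  have hpos : 1 ≤ ∑ k ∈ F₀, ρ k * (b k - R) := by
    rw [Finset.sum_union hGH]
    have : (G.card : ℝ) ≤ ∑ k ∈ G, ρ k * (b k - R) := by
      rw [← nsmul_one]
      refine Finset.card_nsmul_le_sum _ _ _ fun k hk => ?_
      have h1 : R + 1 ≤ b k := by simpa using hGs hk
      nlinarith [hρ k]
    rw [hGc] at this
    linarith
  obtain ⟨A₁, hA₁⟩ : ∃ A₁ : ℝ, R ≤ A₁ ∧ 0 ≤ A₁ ∧ (∀ k ∈ F₀, b k ≤ A₁) ∧
      ∑ k ∈ F₀, ρ k * b k * (b k - R) ≤ A₁ := by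
    obtain ⟨B, hB⟩ := F₀.finite_toSet.image b |>.bddAbove
    refine ⟨max (max R 0) (max B (∑ k ∈ F₀, ρ k * b k * (b k - R))), ?_, ?_, fun k hk => ?_, ?_⟩
    · exact le_max_of_le_left (le_max_left _ _)
    · exact le_max_of_le_left (le_max_right _ _)
    · exact le_max_of_le_right (le_max_of_le_left (hB ⟨k, hk, rfl⟩))
    · exact le_max_of_le_right (le_max_right _ _)
  obtain ⟨hRA, hA0, hbA, hsA⟩ := hA₁
  let F : Finset ℤ := (hfin A₁).toFinset ∪ F₀
  have hF : ∀ k ∉ F, A₁ ≤ b k := fun k hk => by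
    have : k ∉ (hfin A₁).toFinset := fun h => hk (Finset.mem_union_left _ h)
    simpa using this
  let g : ℝ → ℝ := fun A => ∑ k ∈ F, ρ k * max (A - b k) 0 * (b k - R)
  have hg : Continuous g := by fun_prop
  have hgR : g R ≤ 0 := by
    refine Finset.sum_nonpos fun k _ => ?_
    rcases le_total R (b k) with h | h
    · rw [max_eq_right (by linarith)]; simp
    · exact mul_nonpos_of_nonneg_of_nonpos
        (mul_nonneg (by linarith [hρ k]) (le_max_right _ _)) (by linarith)
  have hgA : 0 ≤ g A₁ := by
    have h1 : ∑ k ∈ F₀, ρ k * max (A₁ - b k) 0 * (b k - R) ≤ g A₁ := by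
      refine Finset.sum_le_sum_of_subset_of_nonneg Finset.subset_union_right fun k _ hk => ?_
      have : k ∉ H := fun h => hk (Finset.mem_union_left _ h)
      exact mul_nonneg (mul_nonneg (by linarith [hρ k]) (le_max_right _ _))
        (by linarith [hH k this])
    have h2 : ∑ k ∈ F₀, ρ k * max (A₁ - b k) 0 * (b k - R) =
        A₁ * (∑ k ∈ F₀, ρ k * (b k - R)) - ∑ k ∈ F₀, ρ k * b k * (b k - R) := by
      rw [Finset.mul_sum, ← Finset.sum_sub_distrib]
      refine Finset.sum_congr rfl fun k hk => ?_
      rw [max_eq_left (by linarith [hbA k hk])]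
      ring
    nlinarith
  obtain ⟨A, ⟨h1, h2⟩, h3⟩ := intermediate_value_Icc hRA hg.continuousOn ⟨hgR, hgA⟩
  exact ⟨A, h1, F, fun k hk => h2.trans (hF k hk), h3⟩

lemma finite_abs_rpow_lt {β : ℝ} (hβ : 0 < β) (A : ℝ) :
    {k : ℤ | |(k : ℝ)| ^ β < A}.Finite := by
  refine (Set.finite_Icc (-⌈A ^ β⁻¹⌉) ⌈A ^ β⁻¹⌉).subset fun k hk => ?_
  have hk : |(k : ℝ)| ^ β < A := hk
  have hA : 0 ≤ A := (Real.rpow_nonneg (abs_nonneg _) _).trans hk.le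
  have h1 : |(k : ℝ)| < A ^ β⁻¹ := (Real.lt_rpow_inv_iff_of_pos (abs_nonneg _) hA hβ).2 hk
  have h2 : |(k : ℝ)| ≤ (⌈A ^ β⁻¹⌉ : ℝ) := h1.le.trans (Int.le_ceil _)
  have h3 : |k| ≤ ⌈A ^ β⁻¹⌉ := by exact_mod_cast h2
  exact abs_le.1 h3

/-- The maximin value entering the definition of `sepRate`. -/
def maximinValue (s τ r : ℝ) : ℝ :=
  sSup {x : ℝ | ∃ w : ℤ → ℝ, Summable (fun k : ℤ => (w k) ^ 2) ∧ (∀ k, 0 ≤ w k) ∧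
      (∑' k : ℤ, (w k) ^ 2) = 1 / 2 ∧
      x = sInf {y : ℝ | ∃ θ ∈ SobolevBall τ r,
        y = ∑' k : ℤ, w k * (θ k) ^ 2 / (sigmaSeq s k) ^ 2}}

lemma tsum_weight_nonneg {s : ℝ} {w θ : ℤ → ℝ} (hw : ∀ k, 0 ≤ w k) :
    0 ≤ ∑' k : ℤ, w k * (θ k) ^ 2 / (sigmaSeq s k) ^ 2 :=
  tsum_nonneg fun k => div_nonneg (mul_nonneg (hw k) (sq_nonneg _)) (sq_nonneg _)

lemma maximinValue_nonneg (s τ r : ℝ) : 0 ≤ maximinValue s τ r := by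
  refine Real.sSup_nonneg ?_
  rintro x ⟨w, -, hw, -, rfl⟩
  refine Real.sInf_nonneg ?_
  rintro y ⟨θ, -, rfl⟩
  exact tsum_weight_nonneg hw

/-- A finitely supported element of the Sobolev ball bounds the maximin value. -/
lemma maximinValue_le (s τ r : ℝ) (F : Finset ℤ) (θ : ℤ → ℝ) (hθF : ∀ k ∉ F, θ k = 0)
    (hθ : θ ∈ SobolevBall τ r) (Q : ℝ) (hQ : ∑ k ∈ F, (θ k ^ 2 / sigmaSeq s k ^ 2) ^ 2 = Q) :
    maximinValue s τ r ≤ √(Q / 2) := by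
  refine Real.sSup_le ?_ (Real.sqrt_nonneg _)
  rintro x ⟨w, hws, hw, hw2, rfl⟩
  have hbdd : BddBelow {y : ℝ | ∃ θ ∈ SobolevBall τ r,
      y = ∑' k : ℤ, w k * (θ k) ^ 2 / (sigmaSeq s k) ^ 2} :=
    ⟨0, by rintro y ⟨θ, -, rfl⟩; exact tsum_weight_nonneg hw⟩
  refine (csInf_le hbdd ⟨θ, hθ, rfl⟩).trans ?_
  rw [tsum_eq_sum (s := F) (fun k hk => by simp [hθF k hk])]
  apply Real.le_sqrt_of_sq_le
  simp only [mul_div_assoc]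
  refine (Finset.sum_mul_sq_le_sq_mul_sq F w _).trans ?_
  rw [hQ]
  have h1 : ∑ k ∈ F, w k ^ 2 ≤ 1 / 2 := hw2 ▸ hws.sum_le_tsum F (fun k _ => sq_nonneg _)
  have h2 : 0 ≤ Q := hQ ▸ Finset.sum_nonneg fun k _ => sq_nonneg _
  nlinarith

/-- The water-filling weights are of order at most the inverse square root of their
bandwidth `A ^ (1 / (2 * τ))`. -/
lemma water_filling_weight_le (s τ : ℝ) (hs : 0 ≤ s) (hτ : 0 < τ) (A : ℝ) (hA : 0 < A)
    (F : Finset ℤ) (hF : ∀ k ∉ F, A ≤ |(k : ℝ)| ^ (2 * τ)) (m : ℤ → ℝ)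
    (hm : ∀ k, m k = max (A - |(k : ℝ)| ^ (2 * τ)) 0) (k : ℤ) :
    sigmaSeq s k ^ 4 * m k ^ 2 / (2 * ∑ k ∈ F, sigmaSeq s k ^ 4 * m k ^ 2) ≤
      4 * (4 ^ s) ^ 4 / (1 - (1 / 2 : ℝ) ^ (2 * τ)) ^ 2 / A ^ (2 * τ)⁻¹ := by
  have hτ2 : 0 < 2 * τ := by linarith
  have hδ0 : 0 < 1 - (1 / 2 : ℝ) ^ (2 * τ) := by
    have := Real.rpow_lt_one (x := 1 / 2) (by norm_num) (by norm_num) hτ2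
    linarith
  have hδ1 : 1 - (1 / 2 : ℝ) ^ (2 * τ) ≤ 1 := by
    have := Real.rpow_nonneg (x := 1 / 2) (by norm_num) (2 * τ)
    linarith
  set δ : ℝ := 1 - (1 / 2 : ℝ) ^ (2 * τ) with hδ
  set Q : ℝ := ∑ k ∈ F, sigmaSeq s k ^ 4 * m k ^ 2 with hQdef
  set T : ℝ := A ^ (2 * τ)⁻¹ with hT
  have hT0 : 0 < T := Real.rpow_pos_of_pos hA _
  have hTA : T ^ (2 * τ) = A := Real.rpow_inv_rpow hA.le hτ2.ne'
  have hm0 : ∀ k, 0 ≤ m k := fun k => hm k ▸ le_max_right _ _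
  have hterm : ∀ k, 0 ≤ sigmaSeq s k ^ 4 * m k ^ 2 := fun k =>
    mul_nonneg (pow_nonneg (sigmaSeq_pos s k).le _) (sq_nonneg _)
  have hmF : ∀ k ∉ F, m k = 0 := fun k hk => by
    rw [hm]; exact max_eq_right (by linarith [hF k hk])
  have h4s : (1 : ℝ) ≤ 4 ^ s := Real.one_le_rpow (by norm_num) hs
  have hQ0 : 0 ≤ Q := Finset.sum_nonneg fun k _ => hterm k
  rcases lt_or_ge T 8 with h8 | h8
  · have h1 : sigmaSeq s k ^ 4 * m k ^ 2 / (2 * Q) ≤ 1 / 2 := by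
      have : sigmaSeq s k ^ 4 * m k ^ 2 ≤ Q := by
        by_cases hk : k ∈ F
        · exact Finset.single_le_sum (f := fun k => sigmaSeq s k ^ 4 * m k ^ 2)
            (fun k _ => hterm k) hk
        · rw [hmF k hk]; simpa using hQ0
      rw [div_mul_eq_div_div_swap]
      refine div_le_div_of_nonneg_right (div_le_one_of_le₀ this hQ0) (by norm_num)
    refine h1.trans ?_
    rw [le_div_iff₀ hT0]
    have : (1 : ℝ) ≤ (4 ^ s) ^ 4 / δ ^ 2 := by
      rw [one_le_div (by positivity)]
      exact (pow_le_one₀ hδ0.le hδ1).trans (one_le_pow₀ h4s)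
    rw [mul_div_assoc]
    linarith
  · have hTs : (1 : ℝ) ≤ T ^ s := Real.one_le_rpow (by linarith) hs
    have hnum : sigmaSeq s k ^ 4 * m k ^ 2 ≤ (T ^ s) ^ 4 * A ^ 2 := by
      rcases le_or_gt A (|(k : ℝ)| ^ (2 * τ)) with h | h
      · rw [hm, max_eq_right (by linarith)]
        simp only [ne_eq, OfNat.ofNat_ne_zero, not_false_eq_true, zero_pow, mul_zero]
        positivity
      · have hb : 0 ≤ |(k : ℝ)| ^ (2 * τ) := by positivity
        have h1 : m k ≤ A := by rw [hm]; exact max_le (by linarith) hA.le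
        have h2 : sigmaSeq s k ≤ T ^ s := by
          unfold sigmaSeq
          split_ifs with h0
          · exact hTs
          · refine Real.rpow_le_rpow (abs_nonneg _) ?_ hs
            rw [← hTA] at h
            exact ((Real.rpow_lt_rpow_iff (abs_nonneg _) hT0.le hτ2).1 h).le
        exact mul_le_mul (pow_le_pow_left₀ (sigmaSeq_pos s k).le h2 _)
          (pow_le_pow_left₀ (hm0 k) h1 _) (sq_nonneg _) (by positivity)
    let J : Finset ℤ := Finset.Icc ⌈T / 4⌉ ⌊T / 2⌋
    have hJ : ∀ i ∈ J, T / 4 ≤ (i : ℝ) ∧ (i : ℝ) ≤ T / 2 := fun i hi => by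
      obtain ⟨h1, h2⟩ := Finset.mem_Icc.1 hi
      exact ⟨Int.ceil_le.1 h1, Int.le_floor.1 h2⟩
    have hJc : T / 8 ≤ (J.card : ℝ) := by
      have h1 : ((⌊T / 2⌋ + 1 - ⌈T / 4⌉ : ℤ) : ℝ) ≤ (J.card : ℝ) := by
        have : (⌊T / 2⌋ + 1 - ⌈T / 4⌉ : ℤ) ≤ (J.card : ℤ) := by
          rw [Int.card_Icc]; exact Int.self_le_toNat _
        exact_mod_cast this
      push_cast at h1
      linarith [Int.sub_one_lt_floor (T / 2), Int.ceil_lt_add_one (T / 4)]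
    have hJt : ∀ i ∈ J, (T ^ s / 4 ^ s) ^ 4 * (A * δ) ^ 2 ≤ sigmaSeq s i ^ 4 * m i ^ 2 := by
      intro i hi
      obtain ⟨h1, h2⟩ := hJ i hi
      have hi0 : 0 < (i : ℝ) := by linarith
      have h3 : T ^ s / 4 ^ s ≤ sigmaSeq s i := by
        have : i ≠ 0 := by rintro rfl; simp at hi0
        rw [sigmaSeq, if_neg this, abs_of_pos hi0, ← Real.div_rpow hT0.le (by norm_num)]
        exact Real.rpow_le_rpow (by positivity) h1 hs
      have h4 : A * δ ≤ m i := by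
        rw [hm, abs_of_pos hi0]
        refine le_max_of_le_left ?_
        have h5 := Real.rpow_le_rpow hi0.le h2 hτ2.le
        rw [div_eq_mul_one_div, Real.mul_rpow hT0.le (by norm_num), hTA] at h5
        rw [hδ]
        linarith
      exact mul_le_mul (pow_le_pow_left₀ (by positivity) h3 _)
        (pow_le_pow_left₀ (by positivity) h4 _) (sq_nonneg _)
        (pow_nonneg (sigmaSeq_pos s i).le _)
    have hJF : J ⊆ F := by
      intro i hi
      by_contra h
      have h1 := hJt i hi
      rw [hmF i h] at h1
      have : 0 < (T ^ s / 4 ^ s) ^ 4 * (A * δ) ^ 2 := by positivity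
      simp at h1
      linarith
    have hQ : T / 8 * ((T ^ s / 4 ^ s) ^ 4 * (A * δ) ^ 2) ≤ Q := by
      refine le_trans ?_ (Finset.sum_le_sum_of_subset_of_nonneg hJF fun i _ _ => hterm i)
      refine le_trans ?_ (Finset.card_nsmul_le_sum J _ _ hJt)
      rw [nsmul_eq_mul]
      exact mul_le_mul_of_nonneg_right hJc (by positivity)
    have hpos : 0 < T / 8 * ((T ^ s / 4 ^ s) ^ 4 * (A * δ) ^ 2) := by positivity
    calc _ ≤ (T ^ s) ^ 4 * A ^ 2 / (2 * (T / 8 * ((T ^ s / 4 ^ s) ^ 4 * (A * δ) ^ 2))) :=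
          div_le_div₀ (by positivity) hnum (by positivity) (by linarith)
      _ = _ := by
          have : T ^ s ≠ 0 := by positivity
          have : (4 : ℝ) ^ s ≠ 0 := by positivity
          field_simp
          norm_num

lemma le_sum_truncated_mul_sq (τ r R A : ℝ) (hR : (2 * Real.pi) ^ (2 * τ) * (R * r ^ 2) = 1)
    (hA : 0 ≤ A) (F : Finset ℤ) (hF : ∀ k ∉ F, A ≤ |(k : ℝ)| ^ (2 * τ)) {θ : ℤ → ℝ}
    (hθ : θ ∈ SobolevBall τ r) :
    (A - R) * r ^ 2 ≤ ∑ k ∈ F, max (A - |(k : ℝ)| ^ (2 * τ)) 0 * θ k ^ 2 := by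
  obtain ⟨h1, h2, h3, h4⟩ := hθ
  have hp : 0 < (2 * Real.pi) ^ (2 * τ) := Real.rpow_pos_of_pos (by positivity) _
  have h5 : ∑' k : ℤ, |(k : ℝ)| ^ (2 * τ) * θ k ^ 2 ≤ R * r ^ 2 := by
    rw [← hR] at h3
    exact le_of_mul_le_mul_left h3 hp
  have hz : ∀ k ∉ F, max (A - |(k : ℝ)| ^ (2 * τ)) 0 * θ k ^ 2 = 0 := fun k hk => by
    rw [max_eq_right (by linarith [hF k hk]), zero_mul]
  have h6 : ∑' k : ℤ, (A * θ k ^ 2 - |(k : ℝ)| ^ (2 * τ) * θ k ^ 2) ≤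
      ∑' k : ℤ, max (A - |(k : ℝ)| ^ (2 * τ)) 0 * θ k ^ 2 := by
    refine Summable.tsum_le_tsum (fun k => ?_) ((h1.mul_left A).sub h2)
      (summable_of_ne_finset_zero (s := F) hz)
    rw [← sub_mul]
    exact mul_le_mul_of_nonneg_right (le_max_left _ _) (sq_nonneg _)
  rw [(h1.mul_left A).tsum_sub h2, tsum_mul_left, tsum_eq_sum hz] at h6
  nlinarith

/-- The optimal weights of the maximin problem are finitely supported, and are uniformly small
when `r` is small. -/
lemma exists_optimal_weights (s τ : ℝ) (hs : 0 ≤ s) (hτ : 0 < τ) :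
    ∃ C : ℝ, 0 < C ∧ ∀ r : ℝ, 0 < r → ∃ (F : Finset ℤ) (w : ℤ → ℝ), (∀ k, 0 ≤ w k) ∧
      ∑ k ∈ F, w k ^ 2 = 1 / 2 ∧ (∀ k, w k ^ 2 ≤ 1 / 2) ∧ (∀ k, w k ^ 2 ≤ C * r ^ (1 / τ)) ∧
      ∀ θ ∈ SobolevBall τ r,
        maximinValue s τ r ≤ ∑ k ∈ F, w k * θ k ^ 2 / sigmaSeq s k ^ 2 := by
  have hτ2 : 0 < 2 * τ := by linarith
  have hδ0 : 0 < 1 - (1 / 2 : ℝ) ^ (2 * τ) := by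
    have := Real.rpow_lt_one (x := 1 / 2) (by norm_num) (by norm_num) hτ2
    linarith
  refine ⟨2 * Real.pi * (4 * (4 ^ s) ^ 4 / (1 - (1 / 2 : ℝ) ^ (2 * τ)) ^ 2), by positivity, fun r hr => ?_⟩
  let b : ℤ → ℝ := fun k => |(k : ℝ)| ^ (2 * τ)
  have hb0 : ∀ k, 0 ≤ b k := fun k => Real.rpow_nonneg (abs_nonneg _) _
  let R : ℝ := ((2 * Real.pi) ^ (2 * τ) * r ^ 2)⁻¹
  have hp : 0 < (2 * Real.pi) ^ (2 * τ) := Real.rpow_pos_of_pos (by positivity) _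
  have hR : 0 < R := by positivity
  have hRr : (2 * Real.pi) ^ (2 * τ) * (R * r ^ 2) = 1 := by
    simp only [R]; field_simp
  have hσ := fun k => one_le_sigmaSeq hs k
  have hσ0 := fun k => sigmaSeq_pos s k
  obtain ⟨A, hRA, F, hF, hsum⟩ := exists_water_level b (fun k => sigmaSeq s k ^ 4)
    (fun k => one_le_pow₀ (hσ k)) (finite_abs_rpow_lt hτ2) R
  have hA : 0 < A := hR.trans_le hRA
  let m : ℤ → ℝ := fun k => max (A - b k) 0
  have hm0 : ∀ k, 0 ≤ m k := fun k => le_max_right _ _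
  have hmF : ∀ k ∉ F, m k = 0 := fun k hk => max_eq_right (by linarith [hF k hk])
  have hmm : ∀ k, m k * m k = m k * (A - b k) := fun k => by
    rcases le_total (b k) A with h | h
    · simp only [m]; rw [max_eq_left (by linarith)]
    · simp only [m]; rw [max_eq_right (by linarith)]; simp
  have hb00 : b 0 = 0 := by simp [b, hτ2.ne']
  have h0F : (0 : ℤ) ∈ F := by
    by_contra h
    have := hF 0 h
    linarith
  have hm00 : m 0 = A := by simp only [m, hb00]; rw [sub_zero, max_eq_left hA.le]
  let Z : ℝ := ∑ k ∈ F, sigmaSeq s k ^ 4 * m k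
  let Q : ℝ := ∑ k ∈ F, sigmaSeq s k ^ 4 * m k ^ 2
  have hZ : 0 < Z := Finset.sum_pos'
    (fun k _ => mul_nonneg (pow_nonneg (hσ0 k).le _) (hm0 k))
    ⟨0, h0F, mul_pos (pow_pos (hσ0 0) _) (hm00 ▸ hA)⟩
  have hQ : 0 < Q := Finset.sum_pos'
    (fun k _ => mul_nonneg (pow_nonneg (hσ0 k).le _) (sq_nonneg _))
    ⟨0, h0F, mul_pos (pow_pos (hσ0 0) _) (pow_pos (hm00 ▸ hA) _)⟩
  have hbZ : ∑ k ∈ F, sigmaSeq s k ^ 4 * m k * b k = R * Z := by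
    have : ∑ k ∈ F, sigmaSeq s k ^ 4 * m k * (b k - R) =
        ∑ k ∈ F, sigmaSeq s k ^ 4 * m k * b k - R * Z := by
      rw [Finset.mul_sum, ← Finset.sum_sub_distrib]
      exact Finset.sum_congr rfl fun k _ => by ring
    linarith [this.symm.trans hsum]
  have hQZ : Q = (A - R) * Z := by
    have : Q = A * Z - ∑ k ∈ F, sigmaSeq s k ^ 4 * m k * b k := by
      rw [Finset.mul_sum, ← Finset.sum_sub_distrib]
      refine Finset.sum_congr rfl fun k _ => ?_
      rw [sq, hmm]; ring
    rw [this, hbZ]; ring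
  have hs2Q : 0 < √(2 * Q) := Real.sqrt_pos.2 (by positivity)
  have hwsq : ∀ k, (sigmaSeq s k ^ 2 * m k / √(2 * Q)) ^ 2 =
      sigmaSeq s k ^ 4 * m k ^ 2 / (2 * Q) := fun k => by
    rw [div_pow, Real.sq_sqrt (by positivity)]; ring
  have hhalf : ∀ k, sigmaSeq s k ^ 4 * m k ^ 2 ≤ Q := fun k => by
    by_cases hk : k ∈ F
    · exact Finset.single_le_sum (f := fun k => sigmaSeq s k ^ 4 * m k ^ 2)
        (fun k _ => mul_nonneg (pow_nonneg (hσ0 k).le _) (sq_nonneg _)) hk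
    · rw [hmF k hk]; simpa using hQ.le
  have hZs : ∑ k ∈ F, sigmaSeq s k ^ 4 * m k = Z := rfl
  have hQs : ∑ k ∈ F, sigmaSeq s k ^ 4 * m k ^ 2 = Q := rfl
  clear_value Z Q
  refine ⟨F, fun k => sigmaSeq s k ^ 2 * m k / √(2 * Q), fun k => ?_, ?_, fun k => ?_,
    fun k => ?_, fun θ hθ => ?_⟩
  · exact div_nonneg (mul_nonneg (sq_nonneg _) (hm0 k)) hs2Q.le
  · simp only [hwsq]
    rw [← Finset.sum_div, hQs]
    field_simp
  · rw [hwsq, div_le_div_iff₀ (by positivity) (by norm_num)]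
    linarith [hhalf k]
  · rw [hwsq, ← hQs]
    refine (water_filling_weight_le s τ hs hτ A hA F hF m (fun _ => rfl) k).trans ?_
    rw [div_eq_mul_inv, mul_comm (2 * Real.pi), mul_assoc]
    refine mul_le_mul_of_nonneg_left ?_ (by positivity)
    have h1 : R ^ (2 * τ)⁻¹ ≤ A ^ (2 * τ)⁻¹ := Real.rpow_le_rpow hR.le hRA (by positivity)
    have h2 : R ^ (2 * τ)⁻¹ = (2 * Real.pi * r ^ (1 / τ))⁻¹ := by
      rw [Real.inv_rpow (by positivity), Real.mul_rpow hp.le (by positivity),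
        Real.rpow_rpow_inv (by positivity) hτ2.ne', ← Real.rpow_natCast_mul hr.le]
      congr 3
      push_cast
      field_simp
    rw [h2] at h1
    exact inv_le_of_inv_le₀ (by positivity) h1
  · have hc : 0 < r ^ 2 / Z := by positivity
    have hv0 : ∀ k, 0 ≤ r ^ 2 / Z * (sigmaSeq s k ^ 4 * m k) := fun k =>
      mul_nonneg hc.le (mul_nonneg (pow_nonneg (hσ0 k).le _) (hm0 k))
    have hvF : ∀ k ∉ F, √(r ^ 2 / Z * (sigmaSeq s k ^ 4 * m k)) = 0 := fun k hk => by
      simp [hmF k hk]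
    have hup : maximinValue s τ r ≤ √((r ^ 2 / Z) ^ 2 * Q / 2) := by
      refine maximinValue_le s τ r F (fun k => √(r ^ 2 / Z * (sigmaSeq s k ^ 4 * m k))) hvF
        ⟨?_, ?_, ?_, ?_⟩ _ ?_
      · exact summable_of_ne_finset_zero (s := F) fun k hk => by simp [hvF k hk]
      · exact summable_of_ne_finset_zero (s := F) fun k hk => by simp [hvF k hk]
      · rw [tsum_eq_sum (s := F) (fun k hk => by simp [hvF k hk])]
        simp only [Real.sq_sqrt (hv0 _)]
        have : ∑ k ∈ F, |(k : ℝ)| ^ (2 * τ) * (r ^ 2 / Z * (sigmaSeq s k ^ 4 * m k)) =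
            r ^ 2 / Z * (R * Z) := by
          rw [← hbZ, Finset.mul_sum]
          exact Finset.sum_congr rfl fun k _ => by simp only [b]; ring
        rw [this, ← hRr]
        apply le_of_eq
        field_simp
      · rw [tsum_eq_sum (s := F) (fun k hk => by simp [hvF k hk])]
        simp only [Real.sq_sqrt (hv0 _)]
        rw [← Finset.mul_sum, hZs]
        exact (div_mul_cancel₀ _ hZ.ne').ge
      · simp only [Real.sq_sqrt (hv0 _)]
        rw [← hQs, Finset.mul_sum]
        refine Finset.sum_congr rfl fun k _ => ?_
        have := (hσ0 k).ne'
        field_simp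
    refine hup.trans ?_
    have h6 := le_sum_truncated_mul_sq τ r R A hRr hA.le F hF hθ
    have h7 : ∑ k ∈ F, sigmaSeq s k ^ 2 * m k / √(2 * Q) * θ k ^ 2 / sigmaSeq s k ^ 2 =
        (∑ k ∈ F, m k * θ k ^ 2) / √(2 * Q) := by
      rw [Finset.sum_div]
      refine Finset.sum_congr rfl fun k _ => ?_
      have := (hσ0 k).ne'
      field_simp
    rw [h7, le_div_iff₀ hs2Q, ← Real.sqrt_mul (by positivity)]
    have h8 : (r ^ 2 / Z) ^ 2 * Q / 2 * (2 * Q) = (r ^ 2 / Z * Q) ^ 2 := by ring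
    rw [h8, Real.sqrt_sq (by positivity)]
    have h9 : r ^ 2 / Z * Q = (A - R) * r ^ 2 := by rw [hQZ]; field_simp
    rw [h9]
    exact h6

/-- There is a test whose type I error and maximal type II error are both at most `e`. -/
def HasTest (s τ ε r : ℝ) (M N m n : ℕ) (e : ℝ) : Prop :=
  ∃ ψ : (Fin M × Fin N × ℤ → ℝ) → ℝ, Measurable ψ ∧ (∀ x, ψ x ∈ Set.Icc (0 : ℝ) 1) ∧
    (∀ P, IsGaussianProductMeasure s ε (fun _ _ _ => 0) P → ∫ x, ψ x ∂P ≤ e) ∧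
    (∀ θ P, IsGaussianProductMeasure s ε θ P → InAlt τ r M N m n θ → ∫ x, (1 - ψ x) ∂P ≤ e)

/-- Non-asymptotic error bound for the scan over a family `𝒮` of blocks that covers all
`m × n` submatrices. -/
lemma exists_hasTest (s τ : ℝ) (hs : 0 ≤ s) (hτ : 0 < τ) :
    ∃ C : ℝ, 0 < C ∧ ∀ (ε r : ℝ) (_ : 0 < ε) (_ : 0 < r) (M N m n : ℕ)
      (𝒮 : Finset (Finset (Fin M × Fin N))) (b : ℝ) (_ : 0 < b)
      (_ : ∀ S ∈ 𝒮, (S.card : ℝ) = b)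
      (_ : ∀ (A : Finset (Fin M)) (B : Finset (Fin N)), A.card = m → B.card = n →
        ∃ S ∈ 𝒮, A ×ˢ B ⊆ S)
      (ω : ℝ) (_ : 0 ≤ ω) (_ : 1 ≤ ω ∨ C * r ^ (1 / τ) ≤ ω ^ 2)
      (t l κ e : ℝ) (_ : 0 ≤ l) (_ : 0 ≤ κ) (_ : 2 * (l * (ω / √b)) < 1)
      (_ : 𝒮.card * Real.exp (-l * t + l ^ 2 / 2 / (1 - 2 * (l * (ω / √b)))) ≤ e)
      (_ : Real.exp (κ * t + κ ^ 2 / 2 -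
        κ * (sepRate s τ ε r * (m * n) / √b) / (1 + 2 * (κ * (ω / √b)))) ≤ e),
      HasTest s τ ε r M N m n e := by
  obtain ⟨C, hC, hw⟩ := exists_optimal_weights s τ hs hτ
  refine ⟨C, hC, ?_⟩
  intro ε r hε hr M N m n 𝒮 b hb0 hb hcov ω hω0 hω t l κ e hl hκ hlω he1 he2
  obtain ⟨F, w, hw0, hwsum, hw1, hwC, hwV⟩ := hw r hr
  have hwω : ∀ k, w k ≤ ω := by
    intro k
    refine le_of_sq_le_sq ?_ hω0
    rcases hω with h | h
    · have := hw1 k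
      nlinarith
    · exact (hwC k).trans h
  obtain ⟨ψ, h1, h2, h3, h4⟩ := exists_scan_test s ε hε 𝒮 b hb0 hb F w ω hw0 hwω hwsum t l κ
    hl hκ hlω
  refine ⟨ψ, h1, h2, fun P hP => (h3 P hP).trans he1, fun θ P hP hθ => ?_⟩
  obtain ⟨A, hA, B, hB, -, hin⟩ := hθ
  obtain ⟨S, hS, hsub⟩ := hcov A B hA hB
  refine (h4 θ P hP S hS _ ?_).trans he2
  have hsb : 0 < √b := Real.sqrt_pos.2 hb0
  have e1 : sepRate s τ ε r * (m * n) / √b =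
      (maximinValue s τ r * (m * n)) / (ε ^ 2 * √b) := by
    have : sepRate s τ ε r = (ε ^ 2)⁻¹ * maximinValue s τ r := by
      unfold sepRate maximinValue
      rw [Real.rpow_neg hε.le, Real.rpow_two]
    rw [this]
    field_simp
  rw [e1]
  refine div_le_div_of_nonneg_right ?_ (by positivity)
  have h5 : ∀ q : Fin M × Fin N,
      0 ≤ ∑ k ∈ F, w k * θ q.1 q.2 k ^ 2 / sigmaSeq s k ^ 2 := fun q =>
    Finset.sum_nonneg fun k _ => div_nonneg (mul_nonneg (hw0 k) (sq_nonneg _)) (sq_nonneg _)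
  refine le_trans ?_ (Finset.sum_le_sum_of_subset_of_nonneg hsub fun q _ _ => h5 q)
  refine le_trans (le_of_eq ?_) (Finset.card_nsmul_le_sum (A ×ˢ B) _ (maximinValue s τ r)
    fun q hq => hwV _ (hin q.1 (Finset.mem_product.1 hq).1 q.2 (Finset.mem_product.1 hq).2))
  rw [nsmul_eq_mul, Finset.card_product, hA, hB]
  push_cast
  ring

/-- The family of all `m × n` submatrices. -/
def submatrixBlocks (M N m n : ℕ) : Finset (Finset (Fin M × Fin N)) :=
  ((Finset.univ.powersetCard m : Finset (Finset (Fin M))) ×ˢ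
    (Finset.univ.powersetCard n : Finset (Finset (Fin N)))).image fun AB => AB.1 ×ˢ AB.2

lemma product_mem_submatrixBlocks {M N m n : ℕ} {A : Finset (Fin M)} {B : Finset (Fin N)}
    (hA : A.card = m) (hB : B.card = n) : A ×ˢ B ∈ submatrixBlocks M N m n :=
  Finset.mem_image.2 ⟨(A, B), by simp [hA, hB], rfl⟩

lemma card_of_mem_submatrixBlocks {M N m n : ℕ} {S : Finset (Fin M × Fin N)}
    (hS : S ∈ submatrixBlocks M N m n) : S.card = m * n := by
  obtain ⟨⟨A, B⟩, hAB, rfl⟩ := Finset.mem_image.1 hS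
  simp only [Finset.mem_product, Finset.mem_powersetCard, Finset.subset_univ, true_and] at hAB
  rw [Finset.card_product, hAB.1, hAB.2]

lemma choose_le_exp {M m : ℕ} (hm : 0 < m) (hmM : m ≤ M) :
    (M.choose m : ℝ) ≤ Real.exp (m * Real.log (M / m) + m) := by
  have hm' : (0 : ℝ) < m := by exact_mod_cast hm
  have hM' : (0 : ℝ) < M := by exact_mod_cast hm.trans_le hmM
  have h1 := Nat.choose_le_pow_div (α := ℝ) m M
  have h2 := Real.pow_div_factorial_le_exp (x := (m : ℝ)) hm'.le m
  have h3 : Real.exp (m * Real.log (M / m)) = (M / m : ℝ) ^ m := by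
    rw [← Real.rpow_natCast, Real.rpow_def_of_pos (by positivity), mul_comm]
  rw [Real.exp_add, h3]
  refine h1.trans ?_
  calc (M : ℝ) ^ m / (m.factorial : ℝ) = (M / m : ℝ) ^ m * ((m : ℝ) ^ m / m.factorial) := by
        rw [div_pow]; field_simp
    _ ≤ _ := mul_le_mul_of_nonneg_left h2 (by positivity)

lemma card_submatrixBlocks_le {M N m n : ℕ} (hm : 0 < m) (hmM : m ≤ M) (hn : 0 < n)
    (hnN : n ≤ N) :
    ((submatrixBlocks M N m n).card : ℝ) ≤
      Real.exp (m * Real.log (M / m) + n * Real.log (N / n) + (m + n)) := by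
  have h1 : (submatrixBlocks M N m n).card ≤ M.choose m * N.choose n := by
    refine Finset.card_image_le.trans ?_
    simp [Finset.card_product, Finset.card_powersetCard]
  have h2 : ((submatrixBlocks M N m n).card : ℝ) ≤ M.choose m * N.choose n := by
    exact_mod_cast h1
  refine h2.trans ?_
  rw [show (m * Real.log (M / m) + n * Real.log (N / n) + (m + n) : ℝ) =
    (m * Real.log (M / m) + m) + (n * Real.log (N / n) + n) by ring, Real.exp_add]
  exact mul_le_mul (choose_le_exp hm hmM) (choose_le_exp hn hnN) (by positivity) (by positivity)

lemma sepRate_nonneg (s τ : ℝ) {ε : ℝ} (hε : 0 < ε) (r : ℝ) : 0 ≤ sepRate s τ ε r :=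
  mul_nonneg (Real.rpow_nonneg hε.le _) (maximinValue_nonneg s τ r)

/-- The global chi-square test. -/
lemma hasTest_chiSquare (s τ : ℝ) (hs : 0 ≤ s) (hτ : 0 < τ) (ε r : ℝ) (hε : 0 < ε) (hr : 0 < r)
    (M N m n : ℕ) (hM : 0 < M) (hN : 0 < N) :
    HasTest s τ ε r M N m n
      (Real.exp (1 / 16 - sepRate s τ ε r * (m * n) / √(M * N) / 24)) := by
  obtain ⟨C, hC, h⟩ := exists_hasTest s τ hs hτ
  have hb : (1 : ℝ) ≤ M * N := by
    have : 1 ≤ M * N := Nat.mul_pos hM hN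
    exact_mod_cast this
  set b : ℝ := M * N with hbdef
  have hsb : 1 ≤ √b := Real.one_le_sqrt.2 hb
  set E : ℝ := sepRate s τ ε r * (m * n) / √b with hE
  have hE0 : 0 ≤ E := div_nonneg (mul_nonneg (sepRate_nonneg s τ hε r) (by positivity))
    (by positivity)
  have hρ1 : 1 / √b ≤ 1 := (div_le_one (by linarith)).2 hsb
  have hρ0 : 0 ≤ 1 / √b := by positivity
  refine h ε r hε hr M N m n {Finset.univ} b (by linarith) ?_
    (fun A B _ _ => ⟨Finset.univ, by simp, Finset.subset_univ _⟩) 1 zero_le_one (Or.inl le_rfl)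
    (E / 2) (1 / 4) (1 / 4) _ (by norm_num) (by norm_num) (by linarith) ?_ ?_
  · intro S hS
    rw [Finset.mem_singleton.1 hS, Finset.card_univ, Fintype.card_prod]
    simp [hbdef]
  · rw [Finset.card_singleton, Nat.cast_one, one_mul, Real.exp_le_exp]
    have : (1 / 4 : ℝ) ^ 2 / 2 / (1 - 2 * (1 / 4 * (1 / √b))) ≤ 1 / 16 := by
      rw [div_le_iff₀ (by linarith)]; linarith
    linarith
  · rw [Real.exp_le_exp]
    have : E / 6 ≤ 1 / 4 * E / (1 + 2 * (1 / 4 * (1 / √b))) := by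
      rw [le_div_iff₀ (by linarith)]; nlinarith
    linarith

/-- The scan test over all submatrices of the given size. -/
lemma exists_hasTest_scan (s τ : ℝ) (hs : 0 ≤ s) (hτ : 0 < τ) :
    ∃ C : ℝ, 0 < C ∧ ∀ (ε r : ℝ) (_ : 0 < ε) (_ : 0 < r) (M N m n : ℕ)
      (_ : 0 < m) (_ : m ≤ M) (_ : 0 < n) (_ : n ≤ N) (c D t ρ η : ℝ) (_ : 1 < c)
      (_ : D = m * Real.log (M / m) + n * Real.log (N / n)) (_ : t ^ 2 = 2 * c * D) (_ : 1 ≤ t)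
      (_ : 0 ≤ ρ) (_ : ρ ^ 2 = C * r ^ (1 / τ) / (m * n))
      (_ : η * (1 + c) = (c - 1) / 2) (_ : m + n ≤ η * D)
      (_ : 2 * (t * ρ) < 1) (_ : 1 / (1 - 2 * (t * ρ)) ≤ 1 + η)
      (g : ℝ) (_ : 1 < g) (_ : 1 + 2 * ρ ≤ 2 * g / (1 + g))
      (_ : g * t ≤ sepRate s τ ε r * √(m * n)),
      HasTest s τ ε r M N m n
        (Real.exp (-((c - 1) / 2 * D)) + Real.exp (1 / 2 - t * ((g - 1) / 2))) := by
  obtain ⟨C, hC, h⟩ := exists_hasTest s τ hs hτ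
  refine ⟨C, hC, ?_⟩
  intro ε r hε hr M N m n hm hmM hn hnN c D t ρ η hc hD ht ht1 hρ0 hρ hη hmn htρ htη g hg hρg hE
  have hm' : (0 : ℝ) < m := by exact_mod_cast hm
  have hn' : (0 : ℝ) < n := by exact_mod_cast hn
  have hb : (0 : ℝ) < m * n := by positivity
  set b : ℝ := m * n with hbdef
  have hsb : 0 < √b := Real.sqrt_pos.2 hb
  have hωρ : ρ * √b / √b = ρ := mul_div_cancel_right₀ _ hsb.ne'
  refine h ε r hε hr M N m n (submatrixBlocks M N m n) b hb ?_
    (fun A B hA hB => ⟨_, product_mem_submatrixBlocks hA hB, subset_rfl⟩) (ρ * √b)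
    (by positivity) (Or.inr ?_) t t 1 _ (by linarith) (by norm_num) (by rwa [hωρ]) ?_ ?_
  · intro S hS
    rw [card_of_mem_submatrixBlocks hS, hbdef]
    push_cast
    rfl
  · rw [mul_pow, Real.sq_sqrt hb.le, hρ]
    apply le_of_eq
    field_simp
  · rw [hωρ]
    refine le_trans ?_ (le_add_of_nonneg_right (Real.exp_pos _).le)
    refine (mul_le_mul_of_nonneg_right (card_submatrixBlocks_le hm hmM hn hnN)
      (Real.exp_pos _).le).trans ?_
    rw [← Real.exp_add, Real.exp_le_exp, ← hD]
    have h1 : t ^ 2 / 2 / (1 - 2 * (t * ρ)) ≤ t ^ 2 / 2 * (1 + η) := by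
      rw [div_eq_mul_one_div]
      exact mul_le_mul_of_nonneg_left htη (by positivity)
    have h2 : -t * t = -(2 * c * D) := by rw [← ht]; ring
    rw [ht] at h1
    rw [ht, h2]
    have h3 : η * (1 + c) * D = (c - 1) / 2 * D := by rw [hη]
    nlinarith
  · rw [hωρ]
    refine le_trans ?_ (le_add_of_nonneg_left (Real.exp_pos _).le)
    rw [Real.exp_le_exp]
    have h1 : sepRate s τ ε r * b / √b = sepRate s τ ε r * √b := by
      rw [mul_div_assoc, Real.div_sqrt]
    rw [h1]
    have h2 : t * ((1 + g) / 2) ≤ 1 * (sepRate s τ ε r * √b) / (1 + 2 * (1 * ρ)) := by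
      rw [one_mul, one_mul, le_div_iff₀ (by linarith)]
      refine le_trans ?_ hE
      calc t * ((1 + g) / 2) * (1 + 2 * ρ) ≤ t * ((1 + g) / 2) * (2 * g / (1 + g)) :=
            mul_le_mul_of_nonneg_left hρg (mul_nonneg (by linarith) (by linarith))
        _ = g * t := by
            have : 1 + g ≠ 0 := by linarith
            field_simp
    linarith

/-- A sequence of tests with errors tending to zero can be selected. -/
lemma exists_test_sequence {s τ : ℝ} {ε r : ℕ → ℝ} {M N m n : ℕ → ℕ}
    (P : ∀ j, (Fin (M j) → Fin (N j) → ℤ → ℝ) → Measure (Fin (M j) × Fin (N j) × ℤ → ℝ))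
    (hP : ∀ j θ, IsGaussianProductMeasure s (ε j) θ (P j θ)) {e : ℕ → ℝ}
    (he : Tendsto e atTop (nhds 0))
    (htest : ∀ᶠ j in atTop, HasTest s τ (ε j) (r j) (M j) (N j) (m j) (n j) (e j)) :
    ∃ ψ : ∀ j, (Fin (M j) × Fin (N j) × ℤ → ℝ) → ℝ,
      (∀ j, Measurable (ψ j)) ∧ (∀ j x, ψ j x ∈ Set.Icc (0 : ℝ) 1) ∧
      Tendsto
        (fun j =>
          (∫ x, ψ j x ∂(P j (fun _ _ _ => 0))) +
            sSup {y : ℝ | ∃ θ : Fin (M j) → Fin (N j) → ℤ → ℝ,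
              InAlt τ (r j) (M j) (N j) (m j) (n j) θ ∧
              y = ∫ x, (1 - ψ j x) ∂(P j θ)})
        atTop (nhds 0) := by
  have key : ∀ j, ∃ ψ : (Fin (M j) × Fin (N j) × ℤ → ℝ) → ℝ, Measurable ψ ∧
      (∀ x, ψ x ∈ Set.Icc (0 : ℝ) 1) ∧
      (HasTest s τ (ε j) (r j) (M j) (N j) (m j) (n j) (e j) →
        (∫ x, ψ x ∂(P j (fun _ _ _ => 0)) ≤ e j) ∧
        ∀ θ, InAlt τ (r j) (M j) (N j) (m j) (n j) θ → ∫ x, (1 - ψ x) ∂(P j θ) ≤ e j) := by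
    intro j
    by_cases h : HasTest s τ (ε j) (r j) (M j) (N j) (m j) (n j) (e j)
    · obtain ⟨ψ, h1, h2, h3, h4⟩ := h
      exact ⟨ψ, h1, h2, fun _ => ⟨h3 _ (hP j _), fun θ hθ => h4 θ _ (hP j θ) hθ⟩⟩
    · exact ⟨fun _ => 0, measurable_const, fun _ => by simp, fun h' => absurd h' h⟩
  choose ψ hψ hψ01 hψe using key
  refine ⟨ψ, hψ, hψ01, ?_⟩
  have hnull : ∀ j, 0 ≤ ∫ x, ψ j x ∂(P j (fun _ _ _ => 0)) := fun j =>
    integral_nonneg fun x => (hψ01 j x).1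
  refine squeeze_zero' (Eventually.of_forall fun j => ?_) ?_
    (by simpa using he.add he : Tendsto (fun j => e j + e j) atTop (nhds 0))
  · refine add_nonneg (hnull j) (Real.sSup_nonneg ?_)
    rintro y ⟨θ, -, rfl⟩
    exact integral_nonneg fun x => sub_nonneg.2 (hψ01 j x).2
  · filter_upwards [htest] with j hj
    obtain ⟨h1, h2⟩ := hψe j hj
    refine add_le_add h1 (Real.sSup_le ?_ ((hnull j).trans h1))
    rintro y ⟨θ, hθ, rfl⟩
    exact h2 θ hθ

/-- If `u / v → 0` with `u, v > 0`, then `log (v / u) → ∞`. -/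
lemma tendsto_log_inv_ratio {u v : ℕ → ℕ} (hu : ∀ j, 0 < u j ∧ u j ≤ v j)
    (h : Tendsto (fun j => (u j : ℝ) / (v j : ℝ)) atTop (nhds 0)) :
    Tendsto (fun j => Real.log ((v j : ℝ) / (u j : ℝ))) atTop atTop := by
  refine Real.tendsto_log_atTop.comp ?_
  have h0 : Tendsto (fun j => (u j : ℝ) / (v j : ℝ)) atTop (nhdsWithin 0 (Set.Ioi 0)) :=
    tendsto_nhdsWithin_iff.2 ⟨h, Eventually.of_forall fun j => by
      have h1 : (0 : ℝ) < u j := by exact_mod_cast (hu j).1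
      have h2 : (0 : ℝ) < v j := by exact_mod_cast (hu j).1.trans_le (hu j).2
      exact div_pos h1 h2⟩
  exact h0.inv_tendsto_nhdsGT_zero.congr fun j => by simp

/-- The chi-square test separates when `a² m n p q → ∞`. -/
lemma exists_errors_chiSquare (s τ : ℝ) (hs : 0 ≤ s) (hτ : 0 < τ)
    {ε r : ℕ → ℝ} {M N m n : ℕ → ℕ} (hε : ∀ j, 0 < ε j) (hr : ∀ j, 0 < r j)
    (hM : ∀ j, 0 < M j) (hN : ∀ j, 0 < N j)
    (h : Tendsto (fun j => (sepRate s τ (ε j) (r j)) ^ 2 * (m j : ℝ) * (n j : ℝ) *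
      ((m j : ℝ) / (M j : ℝ)) * ((n j : ℝ) / (N j : ℝ))) atTop atTop) :
    ∃ e : ℕ → ℝ, Tendsto e atTop (nhds 0) ∧
      ∀ᶠ j in atTop, HasTest s τ (ε j) (r j) (M j) (N j) (m j) (n j) (e j) := by
  refine ⟨_, ?_, Eventually.of_forall fun j => hasTest_chiSquare s τ hs hτ (ε j) (r j) (hε j)
    (hr j) (M j) (N j) (m j) (n j) (hM j) (hN j)⟩
  have hE : Tendsto (fun j => sepRate s τ (ε j) (r j) * ((m j : ℝ) * (n j : ℝ)) /
      √((M j : ℝ) * (N j : ℝ))) atTop atTop := by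
    refine (Real.tendsto_sqrt_atTop.comp h).congr fun j => ?_
    have hM' : (0 : ℝ) < M j := by exact_mod_cast hM j
    have hN' : (0 : ℝ) < N j := by exact_mod_cast hN j
    have ha := sepRate_nonneg s τ (hε j) (r j)
    rw [Function.comp_apply, Real.sqrt_eq_iff_mul_self_eq (by positivity) (by positivity), div_mul_div_comm,
      Real.mul_self_sqrt (by positivity)]
    field_simp
  refine Real.tendsto_exp_atBot.comp ?_
  exact tendsto_atBot_add_const_left _ _
    (tendsto_neg_atTop_atBot.comp (hE.atTop_div_const (by norm_num : (0 : ℝ) < 24)))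

/-- The scan test separates when `liminf a² m n / (2 D) > 1` and `D r^(1/τ) / (m n) → 0`. -/
lemma exists_errors_scan (s τ : ℝ) (hs : 0 ≤ s) (hτ : 0 < τ)
    {ε r : ℕ → ℝ} {M N m n : ℕ → ℕ} (hε : ∀ j, 0 < ε j) (hr : ∀ j, 0 < r j)
    (hmM : ∀ j, 0 < m j ∧ m j ≤ M j) (hnN : ∀ j, 0 < n j ∧ n j ≤ N j)
    (hp0 : Tendsto (fun j => (m j : ℝ) / (M j : ℝ)) atTop (nhds 0))
    (hq0 : Tendsto (fun j => (n j : ℝ) / (N j : ℝ)) atTop (nhds 0))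
    {D : ℕ → ℝ}
    (hD : ∀ j, D j = (m j : ℝ) * Real.log ((M j : ℝ) / (m j : ℝ)) +
      (n j : ℝ) * Real.log ((N j : ℝ) / (n j : ℝ)))
    (hlim : 1 < Filter.liminf (fun j => (sepRate s τ (ε j) (r j)) ^ 2 * (m j : ℝ) * (n j : ℝ) /
      (2 * D j)) atTop)
    (hreg : Tendsto (fun j => D j * (r j) ^ (1 / τ) / ((m j : ℝ) * (n j : ℝ))) atTop (nhds 0)) :
    ∃ e : ℕ → ℝ, Tendsto e atTop (nhds 0) ∧
      ∀ᶠ j in atTop, HasTest s τ (ε j) (r j) (M j) (N j) (m j) (n j) (e j) := by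
  obtain ⟨C, hC, hscan⟩ := exists_hasTest_scan s τ hs hτ
  obtain ⟨c₀, hc₀, hev⟩ : ∃ c₀ : ℝ, 1 < c₀ ∧ ∀ᶠ j in atTop,
      c₀ ≤ (sepRate s τ (ε j) (r j)) ^ 2 * (m j : ℝ) * (n j : ℝ) / (2 * D j) := by
    rw [Filter.liminf_eq] at hlim
    have hne : {x : ℝ | ∀ᶠ j in atTop,
        x ≤ (sepRate s τ (ε j) (r j)) ^ 2 * (m j : ℝ) * (n j : ℝ) / (2 * D j)}.Nonempty := by
      by_contra hemp
      rw [Set.not_nonempty_iff_eq_empty] at hemp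
      rw [hemp, Real.sSup_empty] at hlim
      linarith
    obtain ⟨x, hx, h1⟩ := exists_lt_of_lt_csSup hne hlim
    exact ⟨x, h1, hx⟩
  set c : ℝ := (1 + c₀) / 2 with hcdef
  have hc : 1 < c := by linarith
  have hcc₀ : c < c₀ := by linarith
  set η : ℝ := (c - 1) / (2 * (1 + c)) with hηdef
  have hη : 0 < η := div_pos (by linarith) (by linarith)
  have hηc : η * (1 + c) = (c - 1) / 2 := by
    have : 1 + c ≠ 0 := by linarith
    rw [hηdef]
    field_simp
  set g : ℝ := √(c₀ / c) with hgdef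
  have hg : 1 < g := by
    rw [hgdef, Real.lt_sqrt (by norm_num), one_pow, one_lt_div (by linarith)]
    exact hcc₀
  have hm' : ∀ j, (1 : ℝ) ≤ m j := fun j => by exact_mod_cast (hmM j).1
  have hn' : ∀ j, (1 : ℝ) ≤ n j := fun j => by exact_mod_cast (hnN j).1
  have hmn : ∀ᶠ j in atTop, (m j : ℝ) + n j ≤ η * D j := by
    filter_upwards [(tendsto_log_inv_ratio hmM hp0).eventually_ge_atTop (1 / η),
      (tendsto_log_inv_ratio hnN hq0).eventually_ge_atTop (1 / η)] with j h1 h2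
    rw [div_le_iff₀' hη] at h1 h2
    rw [hD]
    nlinarith [hm' j, hn' j]
  have hDtop : Tendsto D atTop atTop := by
    refine tendsto_atTop_mono' _ ?_ (tendsto_log_inv_ratio hmM hp0)
    filter_upwards [(tendsto_log_inv_ratio hmM hp0).eventually_ge_atTop 0,
      (tendsto_log_inv_ratio hnN hq0).eventually_ge_atTop 0] with j h1 h2
    rw [hD]
    nlinarith [hm' j, hn' j]
  set t : ℕ → ℝ := fun j => √(2 * c * D j) with htdef
  set ρ : ℕ → ℝ := fun j => √(C * r j ^ (1 / τ) / (m j * n j)) with hρdef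
  have httop : Tendsto t atTop atTop :=
    Real.tendsto_sqrt_atTop.comp (hDtop.const_mul_atTop (by linarith))
  have hρ0 : ∀ j, 0 ≤ ρ j := fun j => Real.sqrt_nonneg _
  have htρ : Tendsto (fun j => t j * ρ j) atTop (nhds 0) := by
    have h1 : Tendsto (fun j => √(2 * c * C * (D j * (r j) ^ (1 / τ) / ((m j : ℝ) * (n j : ℝ)))))
        atTop (nhds 0) := by
      simpa using (hreg.const_mul (2 * c * C)).sqrt
    refine h1.congr' ?_
    filter_upwards [hDtop.eventually_ge_atTop 0] with j hj
    rw [htdef, hρdef]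
    simp only
    have hc0 : 0 < c := by linarith
    rw [← Real.sqrt_mul (by positivity)]
    congr 1
    ring
  have hρlim : Tendsto ρ atTop (nhds 0) := by
    refine squeeze_zero' (Eventually.of_forall hρ0) ?_ htρ
    filter_upwards [httop.eventually_ge_atTop 1] with j hj
    exact le_mul_of_one_le_left (hρ0 j) hj
  have htρη : ∀ᶠ j in atTop, 1 / (1 - 2 * (t j * ρ j)) ≤ 1 + η := by
    have h1 : Tendsto (fun j => 1 / (1 - 2 * (t j * ρ j))) atTop (nhds 1) := by
      simpa using ((htρ.const_mul 2).const_sub 1).inv₀ (by norm_num)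
    exact h1.eventually_le_const (by linarith)
  have htρ1 : ∀ᶠ j in atTop, 2 * (t j * ρ j) < 1 := by
    have h1 : Tendsto (fun j => 2 * (t j * ρ j)) atTop (nhds 0) := by
      simpa using htρ.const_mul 2
    exact h1.eventually_lt_const (by norm_num)
  have hρg : ∀ᶠ j in atTop, 1 + 2 * ρ j ≤ 2 * g / (1 + g) := by
    have h1 : Tendsto (fun j => 1 + 2 * ρ j) atTop (nhds 1) := by
      simpa using (hρlim.const_mul 2).const_add 1
    refine h1.eventually_le_const ?_
    rw [one_lt_div (by linarith)]
    linarith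
  refine ⟨fun j => Real.exp (-((c - 1) / 2 * D j)) + Real.exp (1 / 2 - t j * ((g - 1) / 2)), ?_,
    ?_⟩
  · have h1 : Tendsto (fun j => Real.exp (-((c - 1) / 2 * D j))) atTop (nhds 0) :=
      Real.tendsto_exp_neg_atTop_nhds_zero.comp (hDtop.const_mul_atTop (by linarith))
    have h2 : Tendsto (fun j => Real.exp (1 / 2 - t j * ((g - 1) / 2))) atTop (nhds 0) :=
      Real.tendsto_exp_atBot.comp (tendsto_atBot_add_const_left _ _
        (tendsto_neg_atTop_atBot.comp (httop.atTop_mul_const (by linarith))))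
    simpa using h1.add h2
  · filter_upwards [hev, hmn, hDtop.eventually_gt_atTop 0, httop.eventually_ge_atTop 1, htρη, htρ1,
      hρg] with j h1 h2 h3 h4 h5 h6 h7
    have hmn0 : (0 : ℝ) < m j * n j := mul_pos (by linarith [hm' j]) (by linarith [hn' j])
    have hc0 : 0 < c := by linarith
    refine hscan (ε j) (r j) (hε j) (hr j) (M j) (N j) (m j) (n j) (hmM j).1 (hmM j).2 (hnN j).1
      (hnN j).2 c (D j) (t j) (ρ j) η hc (hD j) (Real.sq_sqrt (by positivity)) h4 (hρ0 j)
      (Real.sq_sqrt ?_) hηc h2 h6 h5 g hg h7 ?_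
    · have := Real.rpow_nonneg (hr j).le (1 / τ)
      positivity
    · rw [le_div_iff₀ (by positivity)] at h1
      rw [hgdef, htdef, ← Real.sqrt_mul (div_nonneg (by linarith) hc0.le)]
      refine Real.sqrt_le_iff.2 ⟨mul_nonneg (sepRate_nonneg s τ (hε j) (r j))
        (Real.sqrt_nonneg _), ?_⟩
      rw [mul_pow, Real.sq_sqrt hmn0.le]
      have h8 : c₀ / c * (2 * c * D j) = c₀ * (2 * D j) := by field_simp
      rw [h8]
      linarith

/-- Theorem 3.1 of the paper (upper bound): if either `a_j²·m_j n_j p_j q_j → ∞`, or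
`liminf a_j²·m_j n_j/(2D_j) > 1` together with `D_j·r_j^{1/τ}/(m_j n_j) → 0`, then there
is a sequence of tests whose total (type I plus maximal type II) error tends to `0`. -/
theorem detection_upper_bound
    (s τ : ℝ) (hs : 0 ≤ s) (hτ : 0 < τ)
    (ε r : ℕ → ℝ) (M N m n : ℕ → ℕ)
    (hε : ∀ j, 0 < ε j) (hε0 : Tendsto ε atTop (nhds 0))
    (hr : ∀ j, 0 < r j) (hr0 : Tendsto r atTop (nhds 0))
    (hmM : ∀ j, 0 < m j ∧ m j ≤ M j) (hnN : ∀ j, 0 < n j ∧ n j ≤ N j)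
    (hm_top : Tendsto m atTop atTop) (hn_top : Tendsto n atTop atTop)
    (hM_top : Tendsto M atTop atTop) (hN_top : Tendsto N atTop atTop)
    (hp0 : Tendsto (fun j => (m j : ℝ) / (M j : ℝ)) atTop (nhds 0))
    (hq0 : Tendsto (fun j => (n j : ℝ) / (N j : ℝ)) atTop (nhds 0))
    (P : ∀ j, (Fin (M j) → Fin (N j) → ℤ → ℝ) → Measure (Fin (M j) × Fin (N j) × ℤ → ℝ))
    (hP : ∀ j θ, IsGaussianProductMeasure s (ε j) θ (P j θ))
    (a : ℕ → ℝ) (ha : ∀ j, a j = sepRate s τ (ε j) (r j))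
    (D : ℕ → ℝ)
    (hD : ∀ j, D j = (m j : ℝ) * Real.log ((M j : ℝ) / (m j : ℝ)) +
      (n j : ℝ) * Real.log ((N j : ℝ) / (n j : ℝ)))
    (hcond :
      Tendsto (fun j => (a j) ^ 2 * (m j : ℝ) * (n j : ℝ) *
        ((m j : ℝ) / (M j : ℝ)) * ((n j : ℝ) / (N j : ℝ))) atTop atTop ∨
      (1 < Filter.liminf (fun j => (a j) ^ 2 * (m j : ℝ) * (n j : ℝ) / (2 * D j)) atTop ∧
        Tendsto (fun j => D j * (r j) ^ (1 / τ) / ((m j : ℝ) * (n j : ℝ)))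
          atTop (nhds 0))) :
    ∃ ψ : ∀ j, (Fin (M j) × Fin (N j) × ℤ → ℝ) → ℝ,
      (∀ j, Measurable (ψ j)) ∧ (∀ j x, ψ j x ∈ Set.Icc (0 : ℝ) 1) ∧
      Tendsto
        (fun j =>
          (∫ x, ψ j x ∂(P j (fun _ _ _ => 0))) +
            sSup {y : ℝ | ∃ θ : Fin (M j) → Fin (N j) → ℤ → ℝ,
              InAlt τ (r j) (M j) (N j) (m j) (n j) θ ∧
              y = ∫ x, (1 - ψ j x) ∂(P j θ)})
        atTop (nhds 0) := by
  have ha' : a = fun j => sepRate s τ (ε j) (r j) := funext ha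
  subst ha'
  have htests : ∃ e : ℕ → ℝ, Tendsto e atTop (nhds 0) ∧
      ∀ᶠ j in atTop, HasTest s τ (ε j) (r j) (M j) (N j) (m j) (n j) (e j) := by
    rcases hcond with h | ⟨h1, h2⟩
    · exact exists_errors_chiSquare s τ hs hτ hε hr (fun j => (hmM j).1.trans_le (hmM j).2)
        (fun j => (hnN j).1.trans_le (hnN j).2) h
    · exact exists_errors_scan s τ hs hτ hε hr hmM hnN hp0 hq0 hD h1 h2
  obtain ⟨e, he, htest⟩ := htests
  exact exists_test_sequence P hP he htest

end
end
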